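/- Let X be an irreducible plane quartic whose singular locus consists of exactly two ordinary nodes and no other singular points. Then X has exactly 8 theta-lines of type 0 (bitangents), exactly 8 theta-lines of type 1 (four through each node), and exactly 1 theta-line of type 2, namely the line joining the two nodes. -/

import Mathlib

open MvPolynomial

noncomputable section

abbrev P2 : Type := Projectivization ℂ (Fin 3 → ℂ)

/-- The zero locus in `ℙ²` of a polynomial `F`: the points all of whose
representative vectors are zeros of `F`. -/
def curve (F : MvPolynomial (Fin 3) ℂ) : Set P2 :=
  {p | ∀ (w : Fin 3 → ℂ) (hw : w ≠ 0), Projectivization.mk ℂ w hw = p → eval w F = 0}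

/-- The projective line spanned by two vectors. -/
def lineThrough (u v : Fin 3 → ℂ) : Set P2 :=
  {p | ∃ s t : ℂ, ∃ h : s • u + t • v ≠ 0, p = Projectivization.mk ℂ (s • u + t • v) h}

/-- A subset of `ℙ²` is a line if it is the projective span of two
linearly independent vectors. -/
def IsLine (S : Set P2) : Prop :=
  ∃ u v : Fin 3 → ℂ, LinearIndependent ℂ ![u, v] ∧ S = lineThrough u v

/-- The restriction of `F` to the affine parametrization `t ↦ a + t • b` of the line
through `[a]` and `[b]`, as a polynomial in `t`. -/
def lineRest (F : MvPolynomial (Fin 3) ℂ) (a b : Fin 3 → ℂ) : Polynomial ℂ :=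
  eval₂ Polynomial.C (fun i => Polynomial.C (a i) + Polynomial.X * Polynomial.C (b i)) F

/-- The local intersection multiplicity, at the point `[a]`, of the curve `F = 0` with the
line through `[a]` and `[b]` (parametrized by `t ↦ a + t • b`, the point `[a]`
corresponding to `t = 0`). -/
def multAt (F : MvPolynomial (Fin 3) ℂ) (a b : Fin 3 → ℂ) : ℕ :=
  Polynomial.rootMultiplicity 0 (lineRest F a b)

/-- The scheme `X ∩ L` (for `X = {F = 0}`, `L` a line) is everywhere nonreduced: at each
point of `X ∩ L` the local intersection multiplicity is at least `2`.  (Stated over all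
parametrizations of `L`; the base point `a` of a parametrization is a point of `L`, and
every point of `L` occurs as such a base point.) -/
def EverywhereTangent (F : MvPolynomial (Fin 3) ℂ) (S : Set P2) : Prop :=
  ∀ a b : Fin 3 → ℂ, LinearIndependent ℂ ![a, b] → S = lineThrough a b →
    ∀ ha : a ≠ 0, Projectivization.mk ℂ a ha ∈ curve F → 2 ≤ multAt F a b

/-- A theta-line of the quartic `F`: either contained in the curve, or intersecting it
everywhere nonreducedly. -/
def ThetaLine (F : MvPolynomial (Fin 3) ℂ) (S : Set P2) : Prop :=
  IsLine S ∧ (S ⊆ curve F ∨ EverywhereTangent F S)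

/-- A bitangent line of (a smooth curve) `F = 0`: a line, not contained in the curve,
whose scheme-theoretic intersection with the curve is everywhere nonreduced. -/
def Bitangent (F : MvPolynomial (Fin 3) ℂ) (S : Set P2) : Prop :=
  IsLine S ∧ ¬ S ⊆ curve F ∧ EverywhereTangent F S

/-- The line `S` is tangent to the curve `F = 0` at the point `q`: the local intersection
multiplicity there is at least `2`. -/
def TangentAt (F : MvPolynomial (Fin 3) ℂ) (S : Set P2) (q : P2) : Prop :=
  IsLine S ∧ q ∈ S ∧ q ∈ curve F ∧
    ∀ a b : Fin 3 → ℂ, LinearIndependent ℂ ![a, b] → S = lineThrough a b →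
      ∀ ha : a ≠ 0, Projectivization.mk ℂ a ha = q → 2 ≤ multAt F a b

/-- The curve `F = 0` is smooth: `F` and its partial derivatives have no common
projective zero. -/
def SmoothCurve (F : MvPolynomial (Fin 3) ℂ) : Prop :=
  ∀ w : Fin 3 → ℂ, w ≠ 0 → ¬ (eval w F = 0 ∧ ∀ i : Fin 3, eval w (pderiv i F) = 0)

/-- Iterated partial derivative along a list of coordinate directions. -/
def pderivList (l : List (Fin 3)) (F : MvPolynomial (Fin 3) ℂ) : MvPolynomial (Fin 3) ℂ :=
  l.foldr (fun i G => pderiv i G) F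

/-- `F` vanishes to order at least `m` at the point `p` (all partial derivatives of
order `< m` vanish at `p`); i.e. `p` is a point of multiplicity at least `m` of `F = 0`. -/
def VanishesToOrder (F : MvPolynomial (Fin 3) ℂ) (p : P2) (m : ℕ) : Prop :=
  ∀ l : List (Fin 3), l.length < m →
    ∀ (w : Fin 3 → ℂ) (hw : w ≠ 0), Projectivization.mk ℂ w hw = p →
      eval w (pderivList l F) = 0

/-- `p` is a singular point of the curve `F = 0`. -/
def IsSingularAt (F : MvPolynomial (Fin 3) ℂ) (p : P2) : Prop :=
  VanishesToOrder F p 2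

/-- `p` is a double point: a point of multiplicity exactly `2`. -/
def IsDoublePoint (F : MvPolynomial (Fin 3) ℂ) (p : P2) : Prop :=
  VanishesToOrder F p 2 ∧ ¬ VanishesToOrder F p 3

/-- The quadratic form (in the direction `b`) cutting out the tangent cone of `F = 0`
at the double point `[a]`: the degree-`2` Taylor coefficient of `t ↦ F (a + t • b)`. -/
def coneCoeff (F : MvPolynomial (Fin 3) ℂ) (a b : Fin 3 → ℂ) : ℂ :=
  (lineRest F a b).coeff 2

/-- `p` is an ordinary node: a double point whose tangent cone consists of two distinct
lines, i.e. the tangent-cone quadratic has two null directions independent modulo `a`. -/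
def OrdinaryNode (F : MvPolynomial (Fin 3) ℂ) (p : P2) : Prop :=
  IsDoublePoint F p ∧
    ∀ (a : Fin 3 → ℂ) (ha : a ≠ 0), Projectivization.mk ℂ a ha = p →
      ∃ b₁ b₂ : Fin 3 → ℂ, LinearIndependent ℂ ![a, b₁, b₂] ∧
        coneCoeff F a b₁ = 0 ∧ coneCoeff F a b₂ = 0

/-- At the double point `[a]`, the tangent cone is the double line through `[a]` and
`[b₀]`: `b₀` is a null direction of the tangent-cone quadratic, and every null
direction lies on the line spanned by `a` and `b₀`. -/
def DoubleLineCone (F : MvPolynomial (Fin 3) ℂ) (a b₀ : Fin 3 → ℂ) : Prop :=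
  LinearIndependent ℂ ![a, b₀] ∧ coneCoeff F a b₀ = 0 ∧
    ∀ b : Fin 3 → ℂ, coneCoeff F a b = 0 → b ∈ Submodule.span ℂ ({a, b₀} : Set (Fin 3 → ℂ))

/-- `p` is an ordinary cusp: a double point whose tangent cone is a double line `L₀`
with local intersection multiplicity `i(L₀ · X) = 3` at `p`. -/
def OrdinaryCusp (F : MvPolynomial (Fin 3) ℂ) (p : P2) : Prop :=
  IsDoublePoint F p ∧
    ∀ (a : Fin 3 → ℂ) (ha : a ≠ 0), Projectivization.mk ℂ a ha = p →
      ∃ b₀ : Fin 3 → ℂ, DoubleLineCone F a b₀ ∧ multAt F a b₀ = 3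

/-- `p` is an ordinary tacnode: a double point whose tangent cone is a double line `L₀`
with local intersection multiplicity `i(L₀ · X) = 4` at `p`. -/
def OrdinaryTacnode (F : MvPolynomial (Fin 3) ℂ) (p : P2) : Prop :=
  IsDoublePoint F p ∧
    ∀ (a : Fin 3 → ℂ) (ha : a ≠ 0), Projectivization.mk ℂ a ha = p →
      ∃ b₀ : Fin 3 → ℂ, DoubleLineCone F a b₀ ∧ multAt F a b₀ = 4

/-- A theta-line of type `i`: a theta-line, not a component of the curve, containing
exactly `i` singular points of the curve. -/
def ThetaLineOfType (F : MvPolynomial (Fin 3) ℂ) (i : ℕ) (S : Set P2) : Prop :=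
  ThetaLine F S ∧ ¬ S ⊆ curve F ∧ {p | p ∈ S ∧ IsSingularAt F p}.ncard = i

/-- Three points of `ℙ²` are collinear. -/
def Collin (p q r : P2) : Prop :=
  ∃ S : Set P2, IsLine S ∧ p ∈ S ∧ q ∈ S ∧ r ∈ S


/-- An ordinary bitangent: a bitangent meeting the curve at exactly two distinct points,
each with local intersection multiplicity exactly `2`. -/
def OrdinaryBitangent (F : MvPolynomial (Fin 3) ℂ) (S : Set P2) : Prop :=
  Bitangent F S ∧ (S ∩ curve F).ncard = 2 ∧
    ∀ a b : Fin 3 → ℂ, LinearIndependent ℂ ![a, b] → S = lineThrough a b →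
      ∀ ha : a ≠ 0, Projectivization.mk ℂ a ha ∈ curve F → multAt F a b = 2

/-- A bitangent meeting the curve only at smooth points. -/
def SmoothBitangent (F : MvPolynomial (Fin 3) ℂ) (S : Set P2) : Prop :=
  Bitangent F S ∧ ∀ p ∈ S ∩ curve F, ¬ IsSingularAt F p

theorem exists_quadratic_factorization (a b c : ℂ) (ha : a ≠ 0) :
    ∃ r s : ℂ, b = -a * (r + s) ∧ c = a * (r * s) := by
  obtain ⟨d, hd⟩ := IsAlgClosed.exists_pow_nat_eq (b ^ 2 - 4 * a * c) (n := 2) (by norm_num)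
  refine ⟨(-b + d) / (2 * a), (-b - d) / (2 * a), ?_, ?_⟩
  · field_simp; ring
  · field_simp; linear_combination hd

theorem exists_quadratic_root (a b c : ℂ) (ha : a ≠ 0) : ∃ r : ℂ, a * r ^ 2 + b * r + c = 0 := by
  obtain ⟨r, s, h₁, h₂⟩ := exists_quadratic_factorization a b c ha
  exact ⟨r, by rw [h₁, h₂]; ring⟩

theorem exists_square_of_discriminant_eq_zero {a b c : ℂ} (h : b ^ 2 - 4 * a * c = 0) :
    ∃ q r : ℂ, a = q ^ 2 ∧ b = 2 * q * r ∧ c = r ^ 2 := by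
  obtain ⟨q, hq⟩ := IsAlgClosed.exists_pow_nat_eq a (n := 2) (by norm_num)
  by_cases hq0 : q = 0
  · obtain ⟨r, hr⟩ := IsAlgClosed.exists_pow_nat_eq c (n := 2) (by norm_num)
    have ha : a = 0 := by rw [← hq, hq0, zero_pow two_ne_zero]
    exact ⟨0, r, by simp [ha], by simpa [ha] using h, hr.symm⟩
  · refine ⟨q, b / (2 * q), hq.symm, by field_simp, ?_⟩
    field_simp
    linear_combination -h + 4 * c * hq

theorem exists_quartic_root (a b c d e : ℂ) (ha : a ≠ 0) :
    ∃ r : ℂ, a * r ^ 4 + b * r ^ 3 + c * r ^ 2 + d * r + e = 0 := by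
  let p : Polynomial ℂ := .C a * .X ^ 4 + .C b * .X ^ 3 + .C c * .X ^ 2 + .C d * .X + .C e
  have hdeg : p.natDegree = 4 := by simp only [p]; compute_degree!
  obtain ⟨r, hr⟩ := IsAlgClosed.exists_root p fun h => by
    simp [Polynomial.natDegree_eq_of_degree_eq_some h] at hdeg
  exact ⟨r, by simpa [p] using hr⟩

/-- A complex quartic without multiple roots has exactly four roots. -/
theorem ncard_quartic_roots (a b c d e : ℂ) (ha : a ≠ 0)
    (h : ∀ x : ℂ, a * x ^ 4 + b * x ^ 3 + c * x ^ 2 + d * x + e = 0 →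
      4 * a * x ^ 3 + 3 * b * x ^ 2 + 2 * c * x + d ≠ 0) :
    {x : ℂ | a * x ^ 4 + b * x ^ 3 + c * x ^ 2 + d * x + e = 0}.ncard = 4 := by
  let p : Polynomial ℂ := .C a * .X ^ 4 + .C b * .X ^ 3 + .C c * .X ^ 2 + .C d * .X + .C e
  have hdeg : p.natDegree = 4 := by simp only [p]; compute_degree!
  have hp : p ≠ 0 := fun h0 => by simp [h0] at hdeg
  have hset : {x : ℂ | a * x ^ 4 + b * x ^ 3 + c * x ^ 2 + d * x + e = 0} = p.roots.toFinset := by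
    ext x
    simp [hp, p]
  have hnodup : p.roots.Nodup := by
    rw [Multiset.nodup_iff_count_le_one]
    intro x
    rw [Polynomial.count_roots]
    by_contra! hx
    obtain ⟨h₁, h₂⟩ := (Polynomial.one_lt_rootMultiplicity_iff_isRoot hp).1 hx
    refine h x (by simpa [p] using h₁) ?_
    have h₃ : p.derivative.eval x = 0 := h₂
    simp [p] at h₃
    linear_combination h₃
  rw [hset, Set.ncard_coe_finset, Multiset.toFinset_card_of_nodup hnodup,
    IsAlgClosed.card_roots_eq_natDegree, hdeg]

/-- A complex quartic all of whose roots are multiple is a constant times the square of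
`(x - r) * (x - s)`. -/
theorem exists_square_of_multiple_roots (a b c d e : ℂ) (ha : a ≠ 0)
    (h : ∀ x : ℂ, a * x ^ 4 + b * x ^ 3 + c * x ^ 2 + d * x + e = 0 →
      4 * a * x ^ 3 + 3 * b * x ^ 2 + 2 * c * x + d = 0) :
    ∃ r s : ℂ, b = -2 * a * (r + s) ∧ c = a * ((r + s) ^ 2 + 2 * (r * s)) ∧
      d = -2 * a * (r + s) * (r * s) ∧ e = a * (r * s) ^ 2 := by
  obtain ⟨r, hr⟩ := exists_quartic_root a b c d e ha
  have hr' := h r hr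
  obtain ⟨s, t, h₁, h₂⟩ := exists_quadratic_factorization a (b + 2 * r * a)
    (c + 2 * r * (b + 2 * r * a) - r ^ 2 * a) ha
  obtain rfl : b = -a * (s + t) - 2 * r * a := by linear_combination h₁
  obtain rfl : c = a * (s * t) + 2 * r * (a * (s + t)) + r ^ 2 * a := by
    linear_combination h₂
  obtain rfl : d = -2 * a * r * (s * t) - a * r ^ 2 * (s + t) := by linear_combination hr'
  obtain rfl : e = a * r ^ 2 * (s * t) := by linear_combination hr
  have hs : a * ((s - r) ^ 2 * (s - t)) = 0 := by
    linear_combination h s (by ring)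
  have ht : a * ((t - r) ^ 2 * (t - s)) = 0 := by
    linear_combination h t (by ring)
  have hst : s = t := by
    rcases mul_eq_zero.1 ((mul_eq_zero.1 hs).resolve_left ha) with hs | hs
    · obtain rfl : s = r := by linear_combination (pow_eq_zero_iff two_ne_zero).1 hs
      have : (t - s) ^ 3 = 0 := by
        linear_combination (mul_eq_zero.1 ht).resolve_left ha
      linear_combination -(pow_eq_zero_iff three_ne_zero).1 this
    · linear_combination hs
  subst hst
  exact ⟨r, s, by ring, by ring, by ring, by ring⟩

/-- The affine curve `x²y² + Ax² + By² + Cxy + Dx + Ey + G = 0` is smooth and `A`, `B` are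
nonzero. -/
structure SmoothBiquadratic (A B C D E G : ℂ) : Prop where
  A_ne : A ≠ 0
  B_ne : B ≠ 0
  smooth : ∀ x y : ℂ,
    x ^ 2 * y ^ 2 + A * x ^ 2 + B * y ^ 2 + C * x * y + D * x + E * y + G = 0 →
    2 * x * y ^ 2 + 2 * A * x + C * y + D = 0 → 2 * x ^ 2 * y + 2 * B * y + C * x + E = 0 → False

namespace SmoothBiquadratic

variable {A B C D E G : ℂ}

theorem swap (h : SmoothBiquadratic A B C D E G) : SmoothBiquadratic B A C E D G :=
  ⟨h.B_ne, h.A_ne, fun x y h₀ h₁ h₂ => h.smooth y x (by linear_combination h₀)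
    (by linear_combination h₂) (by linear_combination h₁)⟩

/-- The curve does not contain a horizontal line. -/
theorem not_horizontal (h : SmoothBiquadratic A B C D E G) (c : ℂ) (h₂ : c ^ 2 + A = 0)
    (h₁ : C * c + D = 0) (h₀ : B * c ^ 2 + E * c + G = 0) : False := by
  have hc : 2 * c ≠ 0 := by
    rintro hc
    apply h.A_ne
    linear_combination h₂ - c / 2 * hc
  obtain ⟨x, hx⟩ := exists_quadratic_root (2 * c) C (2 * B * c + E) hc
  exact h.smooth x c (by linear_combination x ^ 2 * h₂ + x * h₁ + h₀)
    (by linear_combination 2 * x * h₂ + h₁) (by linear_combination hx)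

theorem ncard_discriminant_roots (h : SmoothBiquadratic A B C D E G) :
    {c : ℂ | (C * c + D) ^ 2 - 4 * (c ^ 2 + A) * (B * c ^ 2 + E * c + G) = 0}.ncard = 4 := by
  have key := ncard_quartic_roots (-4 * B) (-4 * E) (C ^ 2 - 4 * G - 4 * A * B)
    (2 * C * D - 4 * A * E) (D ^ 2 - 4 * A * G) (by simpa using h.B_ne) ?_
  · rw [← key]
    congr 1
    ext c
    simp only [Set.mem_ofPred_eq]
    ring_nf
  intro c h₀ h₁
  by_cases hA : c ^ 2 + A = 0
  · have h₂ : C * c + D = 0 := by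
      refine pow_eq_zero_iff two_ne_zero |>.1 ?_
      linear_combination h₀ + 4 * (B * c ^ 2 + E * c + G) * hA
    have hc : 8 * c ≠ 0 := by
      rintro hc
      apply h.A_ne
      linear_combination hA - c / 8 * hc
    refine h.not_horizontal c hA h₂ ((mul_eq_zero.1 ?_).resolve_left hc)
    linear_combination -h₁ + 2 * C * h₂ - 4 * (2 * B * c + E) * hA
  · obtain ⟨x, hx⟩ : ∃ x, 2 * (c ^ 2 + A) * x + (C * c + D) = 0 :=
      ⟨-(C * c + D) / (2 * (c ^ 2 + A)), by field_simp; ring⟩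
    have hF : x ^ 2 * (c ^ 2 + A) + (C * c + D) * x + (B * c ^ 2 + E * c + G) = 0 := by
      refine (mul_eq_zero.1 ?_).resolve_left hA
      linear_combination -h₀ / 4 +
        ((C * c + D) / 4 + (c ^ 2 + A) * x / 2) * hx
    refine h.smooth x c (by linear_combination hF) (by linear_combination hx)
      ((mul_eq_zero.1 ?_).resolve_left hA)
    linear_combination -h₁ / 4 + (C / 2 + 2 * c * x) * hx - 2 * c * hF

/-- The determinant (up to a factor) of the conic `F - (xy + δ)²`. -/
def conicDet (A B C D E G δ : ℂ) : ℂ :=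
  4 * A * B * (G - δ ^ 2) + (C - 2 * δ) * D * E - A * E ^ 2 - B * D ^ 2 -
    (G - δ ^ 2) * (C - 2 * δ) ^ 2

/-- The conic `F - (xy + δ)²` contains the line `y = mx + c`. -/
def LineInConic (A B C D E G δ m c : ℂ) : Prop :=
  A + B * m ^ 2 + (C - 2 * δ) * m = 0 ∧ 2 * B * m * c + (C - 2 * δ) * c + D + E * m = 0 ∧
    B * c ^ 2 + E * c + G - δ ^ 2 = 0

/-- The conic `F - (xy + δ)²` is not a double line. -/
theorem not_double_line (h : SmoothBiquadratic A B C D E G) (δ m c : ℂ) (hA : A = B * m ^ 2)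
    (hC : C - 2 * δ = -2 * B * m) (hD : D = 2 * B * m * c) (hE : E = -2 * B * c)
    (hG : G - δ ^ 2 = B * c ^ 2) : False := by
  have hm : m ≠ 0 := by
    rintro rfl
    exact h.A_ne (by simpa using hA)
  obtain ⟨x, hx⟩ := exists_quadratic_root m c δ hm
  obtain rfl : C = -2 * B * m + 2 * δ := by linear_combination hC
  obtain rfl : G = B * c ^ 2 + δ ^ 2 := by linear_combination hG
  subst hA hD hE
  refine h.smooth x (m * x + c) ?_ ?_ ?_
  · linear_combination (x * (m * x + c) + δ) * hx
  · linear_combination 2 * (m * x + c) * hx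
  · linear_combination 2 * x * hx

theorem conicDet_of_lineInConic {δ m c : ℂ} (h : LineInConic A B C D E G δ m c) :
    conicDet A B C D E G δ = 0 := by
  obtain ⟨h₁, h₂, h₃⟩ := h
  obtain rfl : A = -B * m ^ 2 - (C - 2 * δ) * m := by linear_combination h₁
  obtain rfl : D = -2 * B * m * c - (C - 2 * δ) * c - E * m := by linear_combination h₂
  obtain rfl : G = -B * c ^ 2 - E * c + δ ^ 2 := by linear_combination h₃
  unfold conicDet
  ring

theorem degenerate_conic (h : SmoothBiquadratic A B C D E G) {δ : ℂ}
    (hdet : conicDet A B C D E G δ = 0) (hdisc : (C - 2 * δ) ^ 2 = 4 * A * B)  :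
    (C - 2 * δ) * E = 2 * B * D ∧ E ^ 2 ≠ 4 * B * (G - δ ^ 2) := by
  have hB := h.B_ne
  unfold conicDet at hdet
  obtain ⟨m, hm⟩ : ∃ m, C - 2 * δ = -2 * B * m := ⟨-(C - 2 * δ) / (2 * B), by field_simp⟩
  have hA : A = B * m ^ 2 := by
    refine mul_left_cancel₀ (show 4 * B ≠ 0 by simpa using hB) ?_
    rw [hm] at hdisc
    linear_combination -hdisc
  have hD : D + E * m = 0 := by
    refine pow_eq_zero_iff two_ne_zero |>.1 (mul_left_cancel₀ hB ?_)
    rw [hm, hA] at hdet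
    linear_combination -hdet
  refine ⟨by rw [hm]; linear_combination -2 * B * hD, fun hE => ?_⟩
  obtain ⟨c, hc⟩ : ∃ c, E = -2 * B * c := ⟨-E / (2 * B), by field_simp⟩
  refine h.not_double_line δ m c hA hm (by linear_combination hD - m * hc) hc ?_
  refine mul_left_cancel₀ (show 4 * B ≠ 0 by simpa using hB) ?_
  rw [hc] at hE
  linear_combination -hE

theorem ncard_conicDet_roots (h : SmoothBiquadratic A B C D E G) :
    {δ : ℂ | conicDet A B C D E G δ = 0}.ncard = 4 := by
  have key := ncard_quartic_roots 4 (-4 * C) (C ^ 2 - 4 * A * B - 4 * G)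
    (4 * C * G - 2 * D * E) (4 * A * B * G + C * D * E - A * E ^ 2 - B * D ^ 2 - C ^ 2 * G)
    (by norm_num) ?_
  · rw [← key]
    congr 1
    ext δ
    simp only [conicDet, Set.mem_ofPred_eq]
    ring_nf
  intro δ h₀ h₁
  have hdet : conicDet A B C D E G δ = 0 := by unfold conicDet; linear_combination h₀
  by_cases hdisc : (C - 2 * δ) ^ 2 = 4 * A * B
  · obtain ⟨hE, hne⟩ := h.degenerate_conic hdet hdisc
    have hC : C - 2 * δ ≠ 0 := by
      intro hC
      rw [hC] at hdisc
      simp [h.A_ne, h.B_ne] at hdisc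
    refine hne (mul_left_cancel₀ hC ?_)
    linear_combination E * hE - B * h₁ + 2 * B * δ * hdisc
  · have hne : 4 * A * B - (C - 2 * δ) ^ 2 ≠ 0 := fun h0 => hdisc (by linear_combination -h0)
    obtain ⟨x, hx⟩ : ∃ x, x * (4 * A * B - (C - 2 * δ) ^ 2) = (C - 2 * δ) * E - 2 * B * D :=
      ⟨_, div_mul_cancel₀ _ hne⟩
    obtain ⟨y, hy⟩ : ∃ y, y * (4 * A * B - (C - 2 * δ) ^ 2) = (C - 2 * δ) * D - 2 * A * E :=
      ⟨_, div_mul_cancel₀ _ hne⟩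
    have e₁ : 2 * A * x + (C - 2 * δ) * y + D = 0 := by
      refine (mul_eq_zero.1 ?_).resolve_left hne
      linear_combination 2 * A * hx + (C - 2 * δ) * hy
    have e₂ : (C - 2 * δ) * x + 2 * B * y + E = 0 := by
      refine (mul_eq_zero.1 ?_).resolve_left hne
      linear_combination 2 * B * hy + (C - 2 * δ) * hx
    have e₃ : D * x + E * y + 2 * (G - δ ^ 2) = 0 := by
      refine (mul_eq_zero.1 ?_).resolve_left hne
      unfold conicDet at hdet
      linear_combination D * hx + E * hy + 2 * hdet
    have e₄ : x * y + δ = 0 := by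
      refine (mul_eq_zero.1 ?_).resolve_left (pow_ne_zero 2 hne)
      unfold conicDet at hdet
      linear_combination (y * (4 * A * B - (C - 2 * δ) ^ 2)) * hx +
        ((C - 2 * δ) * E - 2 * B * D) * hy - (4 * A * B - (C - 2 * δ) ^ 2) / 2 * h₁ +
        2 * (C - 2 * δ) * hdet
    refine h.smooth x y ?_ ?_ ?_
    · linear_combination (x * y + δ) * e₄ + (x * e₁ + y * e₂ + e₃) / 2
    · linear_combination 2 * y * e₄ + e₁
    · linear_combination 2 * x * e₄ + e₂

theorem exists_lines_in_conic (h : SmoothBiquadratic A B C D E G) {δ : ℂ}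
    (hdet : conicDet A B C D E G δ = 0) :
    ∃ S : Finset (ℂ × ℂ), S.card = 2 ∧ ∀ q, q ∈ S ↔ LineInConic A B C D E G δ q.1 q.2 := by
  have hB := h.B_ne
  by_cases hdisc : (C - 2 * δ) ^ 2 = 4 * A * B
  · obtain ⟨hE, hne⟩ := h.degenerate_conic hdet hdisc
    obtain ⟨r, s, h₁, h₂⟩ := exists_quadratic_factorization B E (G - δ ^ 2) hB
    obtain ⟨m, hm⟩ : ∃ m, C - 2 * δ = -2 * B * m := ⟨-(C - 2 * δ) / (2 * B), by field_simp⟩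
    have hA : A = B * m ^ 2 := by
      refine mul_left_cancel₀ (show 4 * B ≠ 0 by simpa using hB) ?_
      rw [hm] at hdisc
      linear_combination -hdisc
    have hD : D + E * m = 0 := by
      refine mul_left_cancel₀ (show 2 * B ≠ 0 by simpa using hB) ?_
      rw [hm] at hE
      linear_combination -hE
    have hrs : r ≠ s := by
      rintro rfl
      apply hne
      rw [h₁, h₂]
      ring
    refine ⟨{(m, r), (m, s)}, Finset.card_pair (by simpa using hrs), fun ⟨n, c⟩ => ?_⟩
    simp only [Finset.mem_insert, Finset.mem_singleton, Prod.mk.injEq, LineInConic]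
    constructor
    · rintro (⟨rfl, rfl⟩ | ⟨rfl, rfl⟩)
      all_goals
        refine ⟨by rw [hA, hm]; ring, by rw [hm]; linear_combination hD, ?_⟩
        rw [add_sub_assoc, h₁, h₂]
        ring
    · rintro ⟨e₁, -, e₃⟩
      obtain rfl : n = m := by
        refine sub_eq_zero.1 (pow_eq_zero_iff two_ne_zero |>.1 (mul_left_cancel₀ hB ?_))
        rw [hA, hm] at e₁
        linear_combination e₁
      have : B * ((c - r) * (c - s)) = 0 := by
        rw [add_sub_assoc, h₁, h₂] at e₃
        linear_combination e₃
      simpa [hB, sub_eq_zero] using this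
  · obtain ⟨r, s, h₁, h₂⟩ := exists_quadratic_factorization B (C - 2 * δ) A hB
    have hrs : r - s ≠ 0 := by
      intro h0
      apply hdisc
      rw [h₁, h₂]
      linear_combination B ^ 2 * (r - s) * h0
    unfold conicDet at hdet
    have key : ∀ m n : ℂ, C - 2 * δ = -B * (m + n) → A = B * (m * n) → m - n ≠ 0 → ∀ c,
        LineInConic A B C D E G δ m c ↔ c = -(D + E * m) / (B * (m - n)) := by
      intro m n h₁ h₂ hmn c
      have hne : B * (m - n) ≠ 0 := mul_ne_zero hB hmn
      rw [eq_div_iff hne, LineInConic, h₁, h₂]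
      rw [h₁, h₂] at hdet
      constructor
      · rintro ⟨-, e, -⟩
        linear_combination e
      · intro e
        refine ⟨by ring, by linear_combination e, ?_⟩
        refine (mul_eq_zero.1 ?_).resolve_left (pow_ne_zero 2 hne)
        linear_combination B * (c * (B * (m - n)) - (D + E * m) + (m - n) * E) * e - hdet
    refine ⟨{(r, -(D + E * r) / (B * (r - s))), (s, -(D + E * s) / (B * (s - r)))},
      Finset.card_pair fun h0 => hrs (sub_eq_zero.2 (Prod.ext_iff.1 h0).1), fun ⟨n, c⟩ => ?_⟩
    simp only [Finset.mem_insert, Finset.mem_singleton, Prod.mk.injEq]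
    rw [← key r s h₁ h₂ hrs, ← key s r (by rw [h₁]; ring) (by rw [h₂]; ring)
      (fun h0 => hrs (by linear_combination -h0))]
    constructor
    · rintro (⟨rfl, h⟩ | ⟨rfl, h⟩) <;> exact h
    · intro h
      have : B * ((n - r) * (n - s)) = 0 := by
        have e := h.1
        rw [h₁, h₂] at e
        linear_combination e
      have : n = r ∨ n = s := by simpa [hB, sub_eq_zero] using this
      rcases this with rfl | rfl <;> simp [h]

theorem ncard_lineInConic (h : SmoothBiquadratic A B C D E G) :
    {q : ℂ × ℂ | q.1 ≠ 0 ∧ ∃ δ, LineInConic A B C D E G δ q.1 q.2}.ncard = 8 := by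
  have h4 := h.ncard_conicDet_roots
  obtain ⟨Z, hZ⟩ := (Set.finite_of_ncard_ne_zero (by rw [h4]; norm_num)).exists_finset_coe
  rw [← hZ, Set.ncard_coe_finset] at h4
  have hZ' : ∀ δ, δ ∈ Z ↔ conicDet A B C D E G δ = 0 := fun δ => by
    rw [← Finset.mem_coe, hZ, Set.mem_ofPred_eq]
  have hex : ∀ δ, ∃ S : Finset (ℂ × ℂ), δ ∈ Z →
      S.card = 2 ∧ ∀ q, q ∈ S ↔ LineInConic A B C D E G δ q.1 q.2 := fun δ => by
    by_cases hδ : δ ∈ Z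
    · obtain ⟨S, hS⟩ := h.exists_lines_in_conic ((hZ' δ).1 hδ)
      exact ⟨S, fun _ => hS⟩
    · exact ⟨∅, fun h => (hδ h).elim⟩
  choose S hS using hex
  have hne : ∀ {δ m c}, LineInConic A B C D E G δ m c → m ≠ 0 := by
    rintro δ m c ⟨e, -, -⟩ rfl
    exact h.A_ne (by linear_combination e)
  have hset : {q : ℂ × ℂ | q.1 ≠ 0 ∧ ∃ δ, LineInConic A B C D E G δ q.1 q.2} =
      (Z.biUnion S : Finset (ℂ × ℂ)) := by
    ext q
    simp only [Set.mem_ofPred_eq, Finset.coe_biUnion, Finset.mem_coe, Set.mem_iUnion, exists_prop]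
    constructor
    · rintro ⟨-, δ, hq⟩
      have hδ := (hZ' δ).2 (conicDet_of_lineInConic hq)
      exact ⟨δ, hδ, ((hS δ hδ).2 q).2 hq⟩
    · rintro ⟨δ, hδ, hq⟩
      have := ((hS δ hδ).2 q).1 hq
      exact ⟨hne this, δ, this⟩
  rw [hset, Set.ncard_coe_finset, Finset.card_biUnion, Finset.sum_congr rfl fun δ hδ => (hS δ hδ).1,
    Finset.sum_const, h4, smul_eq_mul]
  intro δ hδ ε hε hδε
  rw [Function.onFun, Finset.disjoint_left]
  intro q hq hq'
  have h₁ := ((hS δ hδ).2 q).1 hq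
  have h₂ := ((hS ε hε).2 q).1 hq'
  refine hδε (mul_left_cancel₀ (hne h₁) ?_)
  linear_combination (h₂.1 - h₁.1) / 2

end SmoothBiquadratic

open SmoothBiquadratic in
theorem lineInConic_of_multiple_roots {A B C D E G m c : ℂ} (hm : m ≠ 0)
    (h : ∀ x : ℂ, m ^ 2 * x ^ 4 + 2 * m * c * x ^ 3 + (c ^ 2 + A + B * m ^ 2 + C * m) * x ^ 2 +
        (2 * B * m * c + C * c + D + E * m) * x + (B * c ^ 2 + E * c + G) = 0 →
      4 * m ^ 2 * x ^ 3 + 3 * (2 * m * c) * x ^ 2 + 2 * (c ^ 2 + A + B * m ^ 2 + C * m) * x +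
        (2 * B * m * c + C * c + D + E * m) = 0) :
    ∃ δ, LineInConic A B C D E G δ m c := by
  obtain ⟨r, s, h₁, h₂, h₃, h₄⟩ := exists_square_of_multiple_roots _ _ _ _ _
    (pow_ne_zero 2 hm) h
  obtain rfl : c = - m * (r + s) := by
    refine mul_left_cancel₀ (mul_ne_zero two_ne_zero hm) ?_
    linear_combination h₁
  exact ⟨m * (r * s), by linear_combination h₂, by linear_combination h₃, by linear_combination h₄⟩

section LineRestriction

variable {F : MvPolynomial (Fin 3) ℂ} {a b : Fin 3 → ℂ}

theorem eval_lineRest (F : MvPolynomial (Fin 3) ℂ) (a b : Fin 3 → ℂ) (t : ℂ) :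
    (lineRest F a b).eval t = eval (a + t • b) F := by
  induction F using MvPolynomial.induction_on with
  | C r => simp [lineRest]
  | add p q hp hq => simpa [lineRest] using congrArg₂ (· + ·) hp hq
  | mul_X p i hp =>
    simp only [lineRest, eval₂_mul, eval₂_X, Polynomial.eval_mul, eval_mul, eval_X] at hp ⊢
    rw [hp]
    simp [mul_comm t]

theorem coeff_zero_lineRest (F : MvPolynomial (Fin 3) ℂ) (a b : Fin 3 → ℂ) :
    (lineRest F a b).coeff 0 = eval a F := by
  rw [Polynomial.coeff_zero_eq_eval_zero, eval_lineRest]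
  simp

theorem coeff_one_lineRest (F : MvPolynomial (Fin 3) ℂ) (a b : Fin 3 → ℂ) :
    (lineRest F a b).coeff 1 = ∑ i, b i * eval a (pderiv i F) := by
  induction F using MvPolynomial.induction_on with
  | C r => simp [lineRest]
  | add p q hp hq =>
    have : lineRest (p + q) a b = lineRest p a b + lineRest q a b := eval₂_add _ _
    simp [this, hp, hq, mul_add, Finset.sum_add_distrib]
  | mul_X p i hp =>
    have : lineRest (p * X i) a b =
        lineRest p a b * (Polynomial.C (a i) + Polynomial.X * Polynomial.C (b i)) := by
      simp [lineRest]
    rw [this, Polynomial.mul_coeff_one, coeff_zero_lineRest, hp]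
    simp [Derivation.leibniz, pderiv_X, Pi.single_apply, Polynomial.coeff_C, mul_add,
      Finset.sum_add_distrib, Finset.sum_mul, apply_ite]
    exact congrArg₂ (· + ·) (mul_comm _ _) (Finset.sum_congr rfl fun j _ => by ring)

theorem lineRest_eq {e₀ e₁ e₂ e₃ e₄ : ℂ} (h : ∀ t : ℂ, eval (a + t • b) F =
      e₀ + e₁ * t + e₂ * t ^ 2 + e₃ * t ^ 3 + e₄ * t ^ 4) :
    lineRest F a b = .C e₀ + .C e₁ * .X + .C e₂ * .X ^ 2 + .C e₃ * .X ^ 3 + .C e₄ * .X ^ 4 :=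
  Polynomial.funext fun t => by simp [eval_lineRest, h]

theorem coeff_one_lineRest_eq {e₀ e₁ e₂ e₃ e₄ : ℂ} (h : ∀ t : ℂ, eval (a + t • b) F =
      e₀ + e₁ * t + e₂ * t ^ 2 + e₃ * t ^ 3 + e₄ * t ^ 4) :
    (lineRest F a b).coeff 1 = e₁ := by
  rw [lineRest_eq h]
  simp [Polynomial.coeff_C, Polynomial.coeff_X_pow]

theorem coneCoeff_eq {e₀ e₁ e₂ e₃ e₄ : ℂ} (h : ∀ t : ℂ, eval (a + t • b) F =
      e₀ + e₁ * t + e₂ * t ^ 2 + e₃ * t ^ 3 + e₄ * t ^ 4) :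
    coneCoeff F a b = e₂ := by
  rw [coneCoeff, lineRest_eq h]
  simp [Polynomial.coeff_X_pow]

theorem two_le_multAt_iff (h : lineRest F a b ≠ 0) :
    2 ≤ multAt F a b ↔ eval a F = 0 ∧ (lineRest F a b).coeff 1 = 0 := by
  rw [multAt, Polynomial.le_rootMultiplicity_iff h, Polynomial.C_0, sub_zero,
    Polynomial.X_pow_dvd_iff, ← coeff_zero_lineRest F a b]
  constructor
  · exact fun h => ⟨h 0 (by norm_num), h 1 (by norm_num)⟩
  · rintro ⟨h₀, h₁⟩ d hd
    interval_cases d <;> assumption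

variable {n : ℕ} (hF : F.IsHomogeneous n)
include hF

theorem eval_smul_of_isHomogeneous (k : ℂ) (x : Fin 3 → ℂ) :
    eval (k • x) F = k ^ n * eval x F := by
  rw [eval_eq, eval_eq, Finset.mul_sum]
  refine Finset.sum_congr rfl fun d hd => ?_
  simp only [Pi.smul_apply, smul_eq_mul, mul_pow, Finset.prod_mul_distrib, Finset.prod_pow_eq_pow_sum]
  rw [hF.degree_eq_sum_deg_support hd]
  ring

theorem mk_mem_curve_iff {x : Fin 3 → ℂ} (hx : x ≠ 0) :
    Projectivization.mk ℂ x hx ∈ curve F ↔ eval x F = 0 := by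
  refine ⟨fun h => h x hx rfl, fun h w hw hwx => ?_⟩
  obtain ⟨k, rfl⟩ := (Projectivization.mk_eq_mk_iff' ℂ w x hw hx).1 hwx
  rw [eval_smul_of_isHomogeneous hF, h, mul_zero]

theorem isSingularAt_mk_iff {x : Fin 3 → ℂ} (hx : x ≠ 0) :
    IsSingularAt F (Projectivization.mk ℂ x hx) ↔
      eval x F = 0 ∧ ∀ i, eval x (pderiv i F) = 0 := by
  constructor
  · intro h
    exact ⟨h [] (by simp) x hx rfl, fun i => h [i] (by simp) x hx rfl⟩
  · rintro ⟨h₀, h₁⟩ l hl w hw hwx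
    obtain ⟨k, rfl⟩ := (Projectivization.mk_eq_mk_iff' ℂ w x hw hx).1 hwx
    match l, hl with
    | [], _ => simp [pderivList, eval_smul_of_isHomogeneous hF, h₀]
    | [i], _ => simp [pderivList, eval_smul_of_isHomogeneous hF.pderiv, h₁]

end LineRestriction

section Lines

variable {F : MvPolynomial (Fin 3) ℂ} {a b : Fin 3 → ℂ}

theorem mk_mem_lineThrough_iff {x : Fin 3 → ℂ} (hx : x ≠ 0) :
    Projectivization.mk ℂ x hx ∈ lineThrough a b ↔ x ∈ Submodule.span ℂ {a, b} := by
  rw [Submodule.mem_span_pair]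
  constructor
  · rintro ⟨s, t, h, he⟩
    obtain ⟨k, rfl⟩ := (Projectivization.mk_eq_mk_iff' ℂ _ _ hx h).1 he
    exact ⟨k * s, k * t, by simp [mul_smul]⟩
  · rintro ⟨s, t, rfl⟩
    exact ⟨s, t, hx, rfl⟩

theorem lineThrough_eq_of_mem_span {a' b' : Fin 3 → ℂ} (h : LinearIndependent ℂ ![a, b])
    (h' : LinearIndependent ℂ ![a', b']) (ha : a' ∈ Submodule.span ℂ {a, b})
    (hb : b' ∈ Submodule.span ℂ {a, b}) : lineThrough a b = lineThrough a' b' := by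
  have hle : Submodule.span ℂ {a', b'} ≤ Submodule.span ℂ {a, b} :=
    Submodule.span_le.2 (by rintro x (rfl | rfl) <;> assumption)
  have e := finrank_span_eq_card h
  have e' := finrank_span_eq_card h'
  rw [Matrix.range_cons_cons_empty, Fintype.card_fin] at e e'
  have heq := Submodule.eq_of_le_of_finrank_eq hle (e'.trans e.symm)
  ext p
  induction p using Projectivization.ind with
  | h x hx => rw [mk_mem_lineThrough_iff, mk_mem_lineThrough_iff, heq]

theorem mem_span_of_lineThrough_subset {a' b' : Fin 3 → ℂ}
    (h : lineThrough a' b' ⊆ lineThrough a b) {x : Fin 3 → ℂ}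
    (hx : x ∈ Submodule.span ℂ {a', b'}) : x ∈ Submodule.span ℂ {a, b} := by
  by_cases h0 : x = 0
  · simp [h0]
  · exact (mk_mem_lineThrough_iff h0).1 (h ((mk_mem_lineThrough_iff h0).2 hx))

variable {n : ℕ} (hF : F.IsHomogeneous n)
include hF

theorem lineThrough_subset_curve (h : ∀ s t : ℂ, eval (s • a + t • b) F = 0) :
    lineThrough a b ⊆ curve F := by
  rintro _ ⟨s, t, hst, rfl⟩
  exact (mk_mem_curve_iff hF hst).2 (h s t)

theorem eval_eq_zero_of_subset_curve (h : lineThrough a b ⊆ curve F) {x : Fin 3 → ℂ} (hx : x ≠ 0)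
    (hx' : x ∈ Submodule.span ℂ {a, b}) : eval x F = 0 :=
  (mk_mem_curve_iff hF hx).1 (h ((mk_mem_lineThrough_iff hx).2 hx'))

theorem lineRest_ne_zero (h : ¬ lineThrough a b ⊆ curve F) : lineRest F a b ≠ 0 := by
  intro h0
  have h₁ : ∀ s t : ℂ, s ≠ 0 → eval (s • a + t • b) F = 0 := by
    intro s t hs
    have : s • a + t • b = s • (a + (t / s) • b) := by
      rw [smul_add, smul_smul, mul_div_cancel₀ _ hs]
    rw [this, eval_smul_of_isHomogeneous hF, ← eval_lineRest, h0]
    simp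
  refine h (lineThrough_subset_curve hF fun s t => ?_)
  rcases ne_or_eq s 0 with hs | rfl
  · exact h₁ s t hs
  have hzero : lineRest F (t • b) a = 0 := by
    refine Polynomial.eq_zero_of_infinite_isRoot _ (Set.Infinite.mono (s := {0}ᶜ) ?_
      (Set.finite_singleton 0).infinite_compl)
    intro s hs
    change Polynomial.eval s _ = 0
    rw [eval_lineRest, add_comm]
    exact h₁ s t hs
  have := eval_lineRest F (t • b) a 0
  rw [hzero] at this
  rw [add_comm, ← this]
  simp

/-- A line on which `F` restricts to a nonzero square is everywhere tangent. -/
theorem everywhereTangent_of_square (hnot : ¬ lineThrough a b ⊆ curve F) {p q r : ℂ}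
    (hsq : ∀ s t : ℂ, eval (s • a + t • b) F = (p * s ^ 2 + q * s * t + r * t ^ 2) ^ 2) :
    EverywhereTangent F (lineThrough a b) := by
  intro a' b' hab' heq ha' hmem
  have hmem' := (mk_mem_curve_iff hF ha').1 hmem
  rw [two_le_multAt_iff (lineRest_ne_zero hF (heq ▸ hnot))]
  refine ⟨hmem', ?_⟩
  have hle := fun x => mem_span_of_lineThrough_subset heq.ge (x := x)
  obtain ⟨s, t, rfl⟩ := Submodule.mem_span_pair.1 (hle _ (Submodule.subset_span (by simp) : a' ∈ _))
  obtain ⟨s', t', rfl⟩ := Submodule.mem_span_pair.1 (hle _ (Submodule.subset_span (by simp) : b' ∈ _))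
  rw [hsq] at hmem'
  have h0 := (pow_eq_zero_iff two_ne_zero).1 hmem'
  rw [coeff_one_lineRest_eq (e₀ := 0) (e₁ := 0)
    (e₂ := (2 * p * s * s' + q * (s * t' + s' * t) + 2 * r * t * t') ^ 2)
    (e₃ := 2 * (2 * p * s * s' + q * (s * t' + s' * t) + 2 * r * t * t') *
      (p * s' ^ 2 + q * s' * t' + r * t' ^ 2))
    (e₄ := (p * s' ^ 2 + q * s' * t' + r * t' ^ 2) ^ 2)]
  intro x
  have : s • a + t • b + x • (s' • a + t' • b) = (s + x * s') • a + (t + x * t') • b := by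
    module
  rw [this, hsq]
  linear_combination (p * s ^ 2 + q * s * t + r * t ^ 2 + 2 * x *
    (2 * p * s * s' + q * (s * t' + s' * t) + 2 * r * t * t') +
    2 * x ^ 2 * (p * s' ^ 2 + q * s' * t' + r * t' ^ 2)) * h0

theorem EverywhereTangent.coeff_one_eq_zero (h : EverywhereTangent F (lineThrough a b))
    (hab : LinearIndependent ℂ ![a, b]) (hnot : ¬ lineThrough a b ⊆ curve F) {s : ℂ}
    (hs : eval (s • a + b) F = 0) : (lineRest F (s • a + b) a).coeff 1 = 0 := by
  have hab' : LinearIndependent ℂ ![s • a + b, a] := by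
    rw [LinearIndependent.pair_iff] at hab ⊢
    intro k l hkl
    obtain ⟨h₁, rfl⟩ := hab (k * s + l) k (by rw [← hkl]; module)
    simpa using h₁
  have heq : lineThrough a b = lineThrough (s • a + b) a :=
    lineThrough_eq_of_mem_span hab hab'
      (Submodule.mem_span_pair.2 ⟨s, 1, by simp⟩) (Submodule.subset_span (by simp))
  have h0 : s • a + b ≠ 0 := hab'.ne_zero 0
  exact ((two_le_multAt_iff (lineRest_ne_zero hF (heq ▸ hnot))).1
    (h _ _ hab' heq h0 ((mk_mem_curve_iff hF h0).2 hs))).2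

end Lines

section Frame

variable {u v w : Fin 3 → ℂ}

theorem frame_coord_eq (h : LinearIndependent ℂ ![u, v, w]) {x y z x' y' z' : ℂ}
    (e : x • u + y • v + z • w = x' • u + y' • v + z' • w) : x = x' ∧ y = y' ∧ z = z' := by
  have := Fintype.linearIndependent_iff.1 h ![x - x', y - y', z - z'] (by
    simp only [Fin.sum_univ_three, Matrix.cons_val]
    rw [← sub_eq_zero.2 e]
    module)
  exact ⟨sub_eq_zero.1 (this 0), sub_eq_zero.1 (this 1), sub_eq_zero.1 (this 2)⟩

theorem frame_coord_eq_zero (h : LinearIndependent ℂ ![u, v, w]) {x y z : ℂ}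
    (e : x • u + y • v + z • w = 0) : x = 0 ∧ y = 0 ∧ z = 0 :=
  frame_coord_eq h (by simpa using e)

theorem exists_frame_coord (h : LinearIndependent ℂ ![u, v, w]) (p : Fin 3 → ℂ) :
    ∃ x y z : ℂ, p = x • u + y • v + z • w := by
  have : p ∈ Submodule.span ℂ (Set.range ![u, v, w]) := by
    rw [h.span_eq_top_of_card_eq_finrank (by simp)]
    trivial
  obtain ⟨c, hc⟩ := (Submodule.mem_span_range_iff_exists_fun ℂ).1 this
  exact ⟨c 0, c 1, c 2, by simpa [Fin.sum_univ_three] using hc.symm⟩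

theorem LinearIndependent.frame_swap (h : LinearIndependent ℂ ![u, v, w]) :
    LinearIndependent ℂ ![v, u, w] := by
  convert h.comp _ (Equiv.swap (0 : Fin 3) 1).injective using 1
  ext i
  fin_cases i <;> rfl

theorem indep_join (h : LinearIndependent ℂ ![u, v, w]) : LinearIndependent ℂ ![u, v] := by
  rw [LinearIndependent.pair_iff]
  intro s t e
  have := frame_coord_eq_zero h (x := s) (y := t) (z := 0) (by rw [← e]; module)
  exact ⟨this.1, this.2.1⟩

theorem indep_horizontal (h : LinearIndependent ℂ ![u, v, w]) (c : ℂ) :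
    LinearIndependent ℂ ![u, c • v + w] := by
  rw [LinearIndependent.pair_iff]
  intro s t e
  have := frame_coord_eq_zero h (x := s) (y := t * c) (z := t) (by rw [← e]; module)
  exact ⟨this.1, this.2.2⟩

theorem indep_affine (h : LinearIndependent ℂ ![u, v, w]) (m c : ℂ) :
    LinearIndependent ℂ ![u + m • v, c • v + w] := by
  rw [LinearIndependent.pair_iff]
  intro s t e
  have := frame_coord_eq_zero h (x := s) (y := s * m + t * c) (z := t) (by rw [← e]; module)
  exact ⟨this.1, this.2.2⟩

/-- With respect to a frame, every line is the line at infinity, horizontal, vertical, or of the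
form `y = mx + c` with `m ≠ 0`. -/
theorem isLine_cases (h : LinearIndependent ℂ ![u, v, w]) {S : Set P2} (hS : IsLine S) :
    S = lineThrough u v ∨ (∃ c : ℂ, S = lineThrough u (c • v + w)) ∨
      (∃ c : ℂ, S = lineThrough v (c • u + w)) ∨
      ∃ m c : ℂ, m ≠ 0 ∧ S = lineThrough (u + m • v) (c • v + w) := by
  obtain ⟨a, b, hab, rfl⟩ := hS
  obtain ⟨a₁, a₂, a₃, ha⟩ := exists_frame_coord h a
  obtain ⟨b₁, b₂, b₃, hb⟩ := exists_frame_coord h b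
  obtain ⟨α, hα⟩ : ∃ α, α = a₂ * b₃ - a₃ * b₂ := ⟨_, rfl⟩
  obtain ⟨β, hβ⟩ : ∃ β, β = a₃ * b₁ - a₁ * b₃ := ⟨_, rfl⟩
  obtain ⟨γ, hγ⟩ : ∃ γ, γ = a₁ * b₂ - a₂ * b₁ := ⟨_, rfl⟩
  have hspan : ∀ s t k : ℂ, k ≠ 0 → ∀ x, k • x = s • a + t • b →
      x ∈ Submodule.span ℂ {a, b} := by
    intro s t k hk x hx
    refine Submodule.mem_span_pair.2 ⟨k⁻¹ * s, k⁻¹ * t, ?_⟩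
    rw [mul_smul, mul_smul, ← smul_add, ← hx, inv_smul_smul₀ hk]
  by_cases hα0 : α = 0
  · by_cases hβ0 : β = 0
    · have hγ0 : γ ≠ 0 := by
        rintro hγ0
        rw [hα0] at hα
        rw [hβ0] at hβ
        rw [hγ0] at hγ
        have hrel : ∀ i j : ℂ, i * a₁ = j * b₁ → i * a₂ = j * b₂ → i * a₃ = j * b₃ → j = 0 := by
          intro i j h₁ h₂ h₃
          have := (LinearIndependent.pair_iff.1 hab i (-j) (by
            rw [ha, hb]
            linear_combination (norm := module) h₁ • u + h₂ • v + h₃ • w)).2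
          simpa using this
        have h₁ := hrel b₁ a₁ (by ring) (by linear_combination hγ) (by linear_combination -hβ)
        have h₂ := hrel b₂ a₂ (by linear_combination -hγ) (by ring) (by linear_combination hα)
        have h₃ := hrel b₃ a₃ (by linear_combination hβ) (by linear_combination -hα) (by ring)
        exact hab.ne_zero 0 (by simp [ha, h₁, h₂, h₃])
      refine Or.inl (lineThrough_eq_of_mem_span hab (indep_join h) (hspan b₂ (-a₂) γ hγ0 _ ?_)
        (hspan (-b₁) a₁ γ hγ0 _ ?_))
      · rw [ha, hb]
        linear_combination (norm := module) hγ • u + (hα0 - hα) • w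
      · rw [ha, hb]
        linear_combination (norm := module) hγ • v + (hβ0 - hβ) • w
    · refine Or.inr (Or.inl ⟨-γ / β, lineThrough_eq_of_mem_span hab (indep_horizontal h _)
        (hspan (-b₃) a₃ β hβ0 _ ?_) (hspan b₁ (-a₁) β hβ0 _ ?_)⟩)
      · rw [ha, hb]
        linear_combination (norm := module) hβ • u + (hα0 - hα) • v
      · rw [ha, hb, smul_add, smul_smul, mul_div_cancel₀ _ hβ0]
        linear_combination (norm := module) hβ • w - hγ • v
  · by_cases hβ0 : β = 0
    · refine Or.inr (Or.inr (Or.inl ⟨-γ / α, lineThrough_eq_of_mem_span hab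
        (indep_horizontal h.frame_swap _)
        (hspan b₃ (-a₃) α hα0 _ ?_) (hspan (-b₂) a₂ α hα0 _ ?_)⟩))
      · rw [ha, hb]
        linear_combination (norm := module) hα • v + (hβ0 - hβ) • u
      · rw [ha, hb, smul_add, smul_smul, mul_div_cancel₀ _ hα0]
        linear_combination (norm := module) hα • w - hγ • u
    · refine Or.inr (Or.inr (Or.inr ⟨-α / β, -γ / β, div_ne_zero (neg_ne_zero.2 hα0) hβ0,
        lineThrough_eq_of_mem_span hab (indep_affine h _ _)
        (hspan (-b₃) a₃ β hβ0 _ ?_) (hspan b₁ (-a₁) β hβ0 _ ?_)⟩))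
      · rw [ha, hb, smul_add, smul_smul, mul_div_cancel₀ _ hβ0]
        linear_combination (norm := module) hβ • u - hα • v
      · rw [ha, hb, smul_add, smul_smul, mul_div_cancel₀ _ hβ0]
        linear_combination (norm := module) hβ • w - hγ • v

theorem mem_span_join_iff (h : LinearIndependent ℂ ![u, v, w]) {x y z : ℂ} :
    x • u + y • v + z • w ∈ Submodule.span ℂ {u, v} ↔ z = 0 := by
  rw [Submodule.mem_span_pair]
  constructor
  · rintro ⟨s, t, e⟩
    exact (frame_coord_eq h (x := s) (y := t) (z := 0) (by rw [← e]; module)).2.2.symm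
  · rintro rfl
    exact ⟨x, y, by module⟩

theorem mem_span_horizontal_iff (h : LinearIndependent ℂ ![u, v, w]) {c x y z : ℂ} :
    x • u + y • v + z • w ∈ Submodule.span ℂ {u, c • v + w} ↔ y = c * z := by
  rw [Submodule.mem_span_pair]
  constructor
  · rintro ⟨s, t, e⟩
    obtain ⟨-, rfl, rfl⟩ := frame_coord_eq h (x := s) (y := c * t) (z := t) (by rw [← e]; module)
    rfl
  · rintro rfl
    exact ⟨x, z, by module⟩

theorem mem_span_affine_iff (h : LinearIndependent ℂ ![u, v, w]) {m c x y z : ℂ} :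
    x • u + y • v + z • w ∈ Submodule.span ℂ {u + m • v, c • v + w} ↔ y = m * x + c * z := by
  rw [Submodule.mem_span_pair]
  constructor
  · rintro ⟨s, t, e⟩
    obtain ⟨rfl, rfl, rfl⟩ :=
      frame_coord_eq h (x := s) (y := m * s + c * t) (z := t) (by rw [← e]; module)
    rfl
  · rintro rfl
    exact ⟨x, z, by module⟩

theorem horizontal_injective (h : LinearIndependent ℂ ![u, v, w]) :
    Function.Injective fun c : ℂ => lineThrough u (c • v + w) := by
  intro c c' e
  have := mem_span_of_lineThrough_subset (Eq.le e) (x := c • v + w) (Submodule.subset_span (by simp))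
  simpa using (mem_span_horizontal_iff h (x := 0) (y := c) (z := 1)).1 (by simpa using this)

theorem affine_injective (h : LinearIndependent ℂ ![u, v, w]) :
    Function.Injective fun q : ℂ × ℂ => lineThrough (u + q.1 • v) (q.2 • v + w) := by
  intro ⟨m, c⟩ ⟨m', c'⟩ e
  have h₁ := mem_span_of_lineThrough_subset (Eq.le e) (x := u + m • v)
    (Submodule.subset_span (by simp))
  have h₂ := mem_span_of_lineThrough_subset (Eq.le e) (x := c • v + w)
    (Submodule.subset_span (by simp))
  have e₁ := (mem_span_affine_iff h (x := 1) (y := m) (z := 0)).1 (by simpa using h₁)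
  have e₂ := (mem_span_affine_iff h (x := 0) (y := c) (z := 1)).1 (by simpa using h₂)
  simp at e₁ e₂
  simp [e₁, e₂]

end Frame

/-- In the frame `u, v, w`, the quartic `F` is the closure of a smooth affine curve
`x²y² + Ax² + By² + Cxy + Dx + Ey + G = 0`, with nodes `p₁ = [u]` and `p₂ = [v]`. -/
structure NodalFrame (F : MvPolynomial (Fin 3) ℂ) (p₁ p₂ : P2) (u v w : Fin 3 → ℂ)
    (A B C D E G : ℂ) : Prop extends SmoothBiquadratic A B C D E G where
  homogeneous : F.IsHomogeneous 4
  indep : LinearIndependent ℂ ![u, v, w]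
  left_eq : ∃ h, p₁ = Projectivization.mk ℂ u h
  right_eq : ∃ h, p₂ = Projectivization.mk ℂ v h
  singular_iff : ∀ p, IsSingularAt F p ↔ p = p₁ ∨ p = p₂
  eval_eq : ∀ x y z : ℂ, eval (x • u + y • v + z • w) F = x ^ 2 * y ^ 2 + A * x ^ 2 * z ^ 2 +
    B * y ^ 2 * z ^ 2 + C * x * y * z ^ 2 + D * x * z ^ 3 + E * y * z ^ 3 + G * z ^ 4

namespace NodalFrame

variable {F : MvPolynomial (Fin 3) ℂ} {p₁ p₂ : P2} {u v w : Fin 3 → ℂ} {A B C D E G : ℂ}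

theorem symm (h : NodalFrame F p₁ p₂ u v w A B C D E G) :
    NodalFrame F p₂ p₁ v u w B A C E D G where
  toSmoothBiquadratic := h.swap
  homogeneous := h.homogeneous
  indep := h.indep.frame_swap
  left_eq := h.right_eq
  right_eq := h.left_eq
  singular_iff p := (h.singular_iff p).trans or_comm
  eval_eq x y z := by
    rw [add_comm (x • v), h.eval_eq]
    ring

theorem left_mem_iff (h : NodalFrame F p₁ p₂ u v w A B C D E G) {a b : Fin 3 → ℂ} :
    p₁ ∈ lineThrough a b ↔ (1 : ℂ) • u + (0 : ℂ) • v + (0 : ℂ) • w ∈ Submodule.span ℂ {a, b} := by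
  obtain ⟨hu, rfl⟩ := h.left_eq
  rw [mk_mem_lineThrough_iff]
  simp

theorem right_mem_iff (h : NodalFrame F p₁ p₂ u v w A B C D E G) {a b : Fin 3 → ℂ} :
    p₂ ∈ lineThrough a b ↔ (0 : ℂ) • u + (1 : ℂ) • v + (0 : ℂ) • w ∈ Submodule.span ℂ {a, b} := by
  rw [h.symm.left_mem_iff, add_comm (_ • v)]

theorem ne (h : NodalFrame F p₁ p₂ u v w A B C D E G) : p₁ ≠ p₂ := by
  obtain ⟨hu, rfl⟩ := h.left_eq
  obtain ⟨hv, rfl⟩ := h.right_eq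
  rw [Ne, Projectivization.mk_eq_mk_iff']
  rintro ⟨k, hk⟩
  simpa using (frame_coord_eq h.indep (x := 0) (y := k) (z := 0) (x' := 1) (y' := 0) (z' := 0)
    (by simpa using hk)).1

theorem setOf_singular_eq (h : NodalFrame F p₁ p₂ u v w A B C D E G) (S : Set P2) :
    {p | p ∈ S ∧ IsSingularAt F p} = S ∩ {p₁, p₂} := by
  ext p
  simp [h.singular_iff, and_or_left]

section Join

variable (h : NodalFrame F p₁ p₂ u v w A B C D E G)
include h

theorem left_mem_join : p₁ ∈ lineThrough u v :=
  h.left_mem_iff.2 ((mem_span_join_iff h.indep).2 rfl)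

theorem right_mem_join : p₂ ∈ lineThrough u v :=
  h.right_mem_iff.2 ((mem_span_join_iff h.indep).2 rfl)

theorem type_join : ThetaLineOfType F 2 (lineThrough u v) := by
  have heval : ∀ s t : ℂ, eval (s • u + t • v) F = (0 * s ^ 2 + 1 * s * t + 0 * t ^ 2) ^ 2 := by
    intro s t
    have := h.eval_eq s t 0
    rw [zero_smul, add_zero] at this
    rw [this]
    ring
  have hnot : ¬ lineThrough u v ⊆ curve F := by
    intro hsub
    have := eval_eq_zero_of_subset_curve h.homogeneous hsub
      (fun h0 => one_ne_zero (frame_coord_eq_zero h.indep h0).1)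
      ((mem_span_join_iff h.indep (x := 1) (y := 1)).2 rfl)
    rw [h.eval_eq] at this
    simp at this
  refine ⟨⟨⟨u, v, indep_join h.indep, rfl⟩,
    Or.inr (everywhereTangent_of_square h.homogeneous hnot heval)⟩, hnot, ?_⟩
  rw [h.setOf_singular_eq, Set.inter_eq_right.2 (Set.pair_subset h.left_mem_join h.right_mem_join),
    Set.ncard_pair h.ne]

theorem type_join_iff {i : ℕ} : ThetaLineOfType F i (lineThrough u v) ↔ i = 2 := by
  refine ⟨fun hi => hi.2.2.symm.trans h.type_join.2.2, ?_⟩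
  rintro rfl
  exact h.type_join

end Join

section Horizontal

variable (h : NodalFrame F p₁ p₂ u v w A B C D E G)
include h

theorem left_mem_horizontal (c : ℂ) : p₁ ∈ lineThrough u (c • v + w) :=
  h.left_mem_iff.2 ((mem_span_horizontal_iff h.indep).2 (by simp))

theorem right_notMem_horizontal (c : ℂ) : p₂ ∉ lineThrough u (c • v + w) := by
  rw [h.right_mem_iff, mem_span_horizontal_iff h.indep]
  simp

theorem eval_horizontal (c s t : ℂ) : eval (s • u + t • (c • v + w)) F =
    t ^ 2 * ((c ^ 2 + A) * s ^ 2 + (C * c + D) * s * t + (B * c ^ 2 + E * c + G) * t ^ 2) := by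
  have : s • u + t • (c • v + w) = s • u + (t * c) • v + t • w := by module
  rw [this, h.eval_eq]
  ring

theorem horizontal_not_subset (c : ℂ) : ¬ lineThrough u (c • v + w) ⊆ curve F := by
  intro hsub
  have hz : ∀ x : ℂ, (c ^ 2 + A) * x ^ 2 + (C * c + D) * x + (B * c ^ 2 + E * c + G) = 0 := by
    intro x
    have := eval_eq_zero_of_subset_curve h.homogeneous hsub
      (fun h0 => one_ne_zero (frame_coord_eq_zero h.indep h0).2.2)
      ((mem_span_horizontal_iff h.indep (x := x) (z := 1)).2 rfl)
    rw [h.eval_eq] at this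
    linear_combination this
  refine h.not_horizontal c ?_ ?_ ?_
  · linear_combination (hz 1 + hz (-1)) / 2 - hz 0
  · linear_combination (hz 1 - hz (-1)) / 2
  · linear_combination hz 0

theorem type_horizontal_iff {i : ℕ} {c : ℂ} : ThetaLineOfType F i (lineThrough u (c • v + w)) ↔
    i = 1 ∧ (C * c + D) ^ 2 - 4 * (c ^ 2 + A) * (B * c ^ 2 + E * c + G) = 0 := by
  have hnot := h.horizontal_not_subset c
  have hindep := indep_horizontal h.indep c
  have hcard : {p | p ∈ lineThrough u (c • v + w) ∧ IsSingularAt F p}.ncard = 1 := by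
    rw [h.setOf_singular_eq, Set.inter_insert_of_mem (h.left_mem_horizontal c),
      Set.inter_singleton_eq_empty.2 (h.right_notMem_horizontal c)]
    simp
  constructor
  · rintro ⟨⟨-, hT⟩, -, hi⟩
    refine ⟨hi.symm.trans hcard, ?_⟩
    have hcoeff : ∀ x, (lineRest F (x • u + (c • v + w)) u).coeff 1 =
        2 * (c ^ 2 + A) * x + (C * c + D) := by
      intro x
      refine coeff_one_lineRest_eq
        (e₀ := (c ^ 2 + A) * x ^ 2 + (C * c + D) * x + (B * c ^ 2 + E * c + G))
        (e₂ := c ^ 2 + A) (e₃ := 0) (e₄ := 0) fun t => ?_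
      have : x • u + (c • v + w) + t • u = (x + t) • u + (1 : ℂ) • (c • v + w) := by module
      rw [this, h.eval_horizontal]
      ring
    have htan : ∀ x, (c ^ 2 + A) * x ^ 2 + (C * c + D) * x + (B * c ^ 2 + E * c + G) = 0 →
        2 * (c ^ 2 + A) * x + (C * c + D) = 0 := by
      intro x hx
      rw [← hcoeff]
      refine (hT.resolve_left hnot).coeff_one_eq_zero h.homogeneous hindep hnot ?_
      have := h.eval_horizontal c x 1
      rw [one_smul] at this
      rw [this, ← hx]
      ring
    by_cases hA : c ^ 2 + A = 0
    · have hC : C * c + D = 0 := by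
        by_contra hC
        refine hC ?_
        have := htan (-(B * c ^ 2 + E * c + G) / (C * c + D)) (by
          rw [hA, mul_div_cancel₀ _ hC]
          ring)
        simpa [hA] using this
      simp [hA, hC]
    · obtain ⟨x, hx⟩ := exists_quadratic_root (c ^ 2 + A) (C * c + D) (B * c ^ 2 + E * c + G) hA
      linear_combination (2 * (c ^ 2 + A) * x + (C * c + D)) * htan x hx - 4 * (c ^ 2 + A) * hx
  · rintro ⟨rfl, hdisc⟩
    refine ⟨⟨⟨_, _, hindep, rfl⟩, Or.inr ?_⟩, hnot, hcard⟩
    obtain ⟨q, r, hq, hqr, hr⟩ := exists_square_of_discriminant_eq_zero hdisc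
    refine everywhereTangent_of_square h.homogeneous hnot (p := 0) (q := q) (r := r) fun s t => ?_
    rw [h.eval_horizontal, hq, hqr, hr]
    ring

end Horizontal

section Affine

variable (h : NodalFrame F p₁ p₂ u v w A B C D E G) {m : ℂ} (hm : m ≠ 0)
include h hm

theorem left_notMem_affine (c : ℂ) : p₁ ∉ lineThrough (u + m • v) (c • v + w) := by
  rw [h.left_mem_iff, mem_span_affine_iff h.indep]
  simpa using hm.symm

omit hm in
theorem right_notMem_affine (c : ℂ) : p₂ ∉ lineThrough (u + m • v) (c • v + w) := by
  rw [h.right_mem_iff, mem_span_affine_iff h.indep]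
  simp

omit hm in
theorem eval_affine (m c s t : ℂ) : eval (s • (u + m • v) + t • (c • v + w)) F =
    m ^ 2 * s ^ 4 + 2 * m * c * s ^ 3 * t + (c ^ 2 + A + B * m ^ 2 + C * m) * s ^ 2 * t ^ 2 +
      (2 * B * m * c + C * c + D + E * m) * s * t ^ 3 + (B * c ^ 2 + E * c + G) * t ^ 4 := by
  have : s • (u + m • v) + t • (c • v + w) = s • u + (m * s + c * t) • v + t • w := by module
  rw [this, h.eval_eq]
  ring

theorem affine_not_subset (c : ℂ) : ¬ lineThrough (u + m • v) (c • v + w) ⊆ curve F := by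
  intro hsub
  have := eval_eq_zero_of_subset_curve h.homogeneous hsub
    (fun h0 => one_ne_zero (frame_coord_eq_zero h.indep h0).1)
    ((mem_span_affine_iff h.indep (x := 1) (z := 0)).2 rfl)
  rw [h.eval_eq] at this
  exact pow_ne_zero 2 hm (by linear_combination this)

theorem type_affine_iff {i : ℕ} {c : ℂ} :
    ThetaLineOfType F i (lineThrough (u + m • v) (c • v + w)) ↔
      i = 0 ∧ ∃ δ, SmoothBiquadratic.LineInConic A B C D E G δ m c := by
  have hnot := h.affine_not_subset hm c
  have hindep := indep_affine h.indep m c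
  have hcard : {p | p ∈ lineThrough (u + m • v) (c • v + w) ∧ IsSingularAt F p}.ncard = 0 := by
    rw [h.setOf_singular_eq, Set.inter_insert_of_notMem (h.left_notMem_affine hm c),
      Set.inter_singleton_eq_empty.2 (h.right_notMem_affine c)]
    simp
  constructor
  · rintro ⟨⟨-, hT⟩, -, hi⟩
    refine ⟨hi.symm.trans hcard, lineInConic_of_multiple_roots hm fun x hx => ?_⟩
    have hz := (hT.resolve_left hnot).coeff_one_eq_zero h.homogeneous hindep hnot (s := x) (by
      have := h.eval_affine m c x 1
      rw [one_smul] at this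
      rw [this, ← hx]
      ring)
    rw [← hz]
    refine (coeff_one_lineRest_eq
      (e₀ := m ^ 2 * x ^ 4 + 2 * m * c * x ^ 3 + (c ^ 2 + A + B * m ^ 2 + C * m) * x ^ 2 +
        (2 * B * m * c + C * c + D + E * m) * x + (B * c ^ 2 + E * c + G))
      (e₂ := 6 * m ^ 2 * x ^ 2 + 6 * m * c * x + (c ^ 2 + A + B * m ^ 2 + C * m))
      (e₃ := 4 * m ^ 2 * x + 2 * m * c) (e₄ := m ^ 2) fun t => ?_).symm
    have : x • (u + m • v) + (c • v + w) + t • (u + m • v) =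
      (x + t) • (u + m • v) + (1 : ℂ) • (c • v + w) := by module
    rw [this, h.eval_affine]
    ring
  · rintro ⟨rfl, δ, h₁, h₂, h₃⟩
    refine ⟨⟨⟨_, _, hindep, rfl⟩, Or.inr ?_⟩, hnot, hcard⟩
    refine everywhereTangent_of_square h.homogeneous hnot (p := m) (q := c) (r := δ) fun s t => ?_
    rw [h.eval_affine]
    linear_combination s ^ 2 * t ^ 2 * h₁ + s * t ^ 3 * h₂ + t ^ 4 * h₃

end Affine

section Count

variable (h : NodalFrame F p₁ p₂ u v w A B C D E G)
include h

theorem eq_join_of_type_two {S : Set P2} (hS : ThetaLineOfType F 2 S) : S = lineThrough u v := by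
  rcases isLine_cases h.indep hS.1.1 with rfl | ⟨c, rfl⟩ | ⟨c, rfl⟩ | ⟨m, c, hm, rfl⟩
  · rfl
  · simpa using (h.type_horizontal_iff.1 hS).1
  · simpa using (h.symm.type_horizontal_iff.1 hS).1
  · simpa using ((h.type_affine_iff hm).1 hS).1

theorem ncard_type_two : {S : Set P2 | ThetaLineOfType F 2 S}.ncard = 1 :=
  Set.ncard_eq_one.2 ⟨lineThrough u v, Set.eq_singleton_iff_unique_mem.2
    ⟨h.type_join, fun _ => h.eq_join_of_type_two⟩⟩

theorem ncard_type_one_left : {S : Set P2 | ThetaLineOfType F 1 S ∧ p₁ ∈ S}.ncard = 4 := by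
  rw [← h.ncard_discriminant_roots, ← Set.ncard_image_of_injective _ (horizontal_injective h.indep)]
  congr 1
  ext S
  constructor
  · rintro ⟨hS, hp⟩
    rcases isLine_cases h.indep hS.1.1 with rfl | ⟨c, rfl⟩ | ⟨c, rfl⟩ | ⟨m, c, hm, rfl⟩
    · simpa using h.type_join_iff.1 hS
    · exact ⟨c, (h.type_horizontal_iff.1 hS).2, rfl⟩
    · exact (h.symm.right_notMem_horizontal c hp).elim
    · simpa using ((h.type_affine_iff hm).1 hS).1
  · rintro ⟨c, hc, rfl⟩
    exact ⟨h.type_horizontal_iff.2 ⟨rfl, hc⟩, h.left_mem_horizontal c⟩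

theorem ncard_type_one : {S : Set P2 | ThetaLineOfType F 1 S}.ncard = 8 := by
  have h₁ := h.ncard_type_one_left
  have h₂ := h.symm.ncard_type_one_left
  have hunion : {S : Set P2 | ThetaLineOfType F 1 S} =
      {S : Set P2 | ThetaLineOfType F 1 S ∧ p₁ ∈ S} ∪
        {S : Set P2 | ThetaLineOfType F 1 S ∧ p₂ ∈ S} := by
    ext S
    refine ⟨fun hS => ?_, fun hS => hS.elim And.left And.left⟩
    rcases isLine_cases h.indep hS.1.1 with rfl | ⟨c, rfl⟩ | ⟨c, rfl⟩ | ⟨m, c, hm, rfl⟩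
    · exact Or.inl ⟨hS, h.left_mem_join⟩
    · exact Or.inl ⟨hS, h.left_mem_horizontal c⟩
    · exact Or.inr ⟨hS, h.symm.left_mem_horizontal c⟩
    · simpa using ((h.type_affine_iff hm).1 hS).1
  rw [hunion, Set.ncard_union_eq _ (Set.finite_of_ncard_ne_zero (by simp [h₁]))
    (Set.finite_of_ncard_ne_zero (by simp [h₂])), h₁, h₂]
  rw [Set.disjoint_left]
  rintro S ⟨hS, hp₁⟩ ⟨-, hp₂⟩
  have := hS.2.2
  rw [h.setOf_singular_eq, Set.inter_eq_right.2 (Set.pair_subset hp₁ hp₂), Set.ncard_pair h.ne] at this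
  norm_num at this

theorem ncard_type_zero : {S : Set P2 | ThetaLineOfType F 0 S}.ncard = 8 := by
  rw [← h.ncard_lineInConic, ← Set.ncard_image_of_injective _ (affine_injective h.indep)]
  congr 1
  ext S
  constructor
  · intro hS
    rcases isLine_cases h.indep hS.1.1 with rfl | ⟨c, rfl⟩ | ⟨c, rfl⟩ | ⟨m, c, hm, rfl⟩
    · simpa using h.type_join_iff.1 hS
    · simpa using (h.type_horizontal_iff.1 hS).1
    · simpa using (h.symm.type_horizontal_iff.1 hS).1
    · exact ⟨(m, c), ⟨hm, ((h.type_affine_iff hm).1 hS).2⟩, rfl⟩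
  · rintro ⟨⟨m, c⟩, ⟨hm, hq⟩, rfl⟩
    exact (h.type_affine_iff hm).2 ⟨rfl, hq⟩

end Count

end NodalFrame

theorem exists_eval_eq_sum_of_isHomogeneous {F : MvPolynomial (Fin 3) ℂ} {n : ℕ}
    (hF : F.IsHomogeneous n) : ∃ c : ℕ → ℕ → ℂ, ∀ x y z : ℂ, eval ![x, y, z] F =
      ∑ i ∈ Finset.range (n + 1), ∑ j ∈ Finset.range (n + 1 - i),
        c i j * x ^ i * y ^ j * z ^ (n - i - j) := by
  have key : ∀ s ⊆ F.support, ∃ c : ℕ → ℕ → ℂ, ∀ x y z : ℂ,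
      ∑ d ∈ s, F.coeff d * ∏ i, ![x, y, z] i ^ d i =
        ∑ i ∈ Finset.range (n + 1), ∑ j ∈ Finset.range (n + 1 - i),
          c i j * x ^ i * y ^ j * z ^ (n - i - j) := by
    intro s
    induction s using Finset.induction_on with
    | empty => exact fun _ => ⟨0, by simp⟩
    | insert d s hd ih =>
      intro hs
      obtain ⟨c, hc⟩ := ih fun x hx => hs (Finset.mem_insert_of_mem hx)
      have hdeg : d 0 + d 1 + d 2 = n := by
        rw [hF.degree_eq_sum_deg_support (hs (Finset.mem_insert_self d s)), ← Finsupp.degree_apply,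
          Finsupp.degree_eq_sum, Fin.sum_univ_three]
      refine ⟨fun i j => (if i = d 0 then if j = d 1 then F.coeff d else 0 else 0) + c i j,
        fun x y z => ?_⟩
      have h2 : n - d 0 - d 1 = d 2 := by omega
      rw [Finset.sum_insert hd, hc]
      simp only [add_mul, Finset.sum_add_distrib, ite_mul, zero_mul, Finset.sum_ite_irrel,
        Finset.sum_const_zero, Finset.sum_ite_eq', Finset.mem_range, Fin.prod_univ_three]
      rw [if_pos (by omega), if_pos (by omega), h2]
      simp [mul_assoc]
  obtain ⟨c, hc⟩ := key _ subset_rfl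
  exact ⟨c, fun x y z => by rw [eval_eq', hc]⟩

theorem exists_eval_frame_eq {F : MvPolynomial (Fin 3) ℂ} (hF : F.IsHomogeneous 4)
    (u v w : Fin 3 → ℂ) : ∃ c : ℕ → ℕ → ℂ, ∀ x y z : ℂ, eval (x • u + y • v + z • w) F =
      c 4 0 * x ^ 4 + c 3 1 * x ^ 3 * y + c 3 0 * x ^ 3 * z + c 2 2 * x ^ 2 * y ^ 2 +
      c 2 1 * x ^ 2 * y * z + c 2 0 * x ^ 2 * z ^ 2 + c 1 3 * x * y ^ 3 +
      c 1 2 * x * y ^ 2 * z + c 1 1 * x * y * z ^ 2 + c 1 0 * x * z ^ 3 + c 0 4 * y ^ 4 +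
      c 0 3 * y ^ 3 * z + c 0 2 * y ^ 2 * z ^ 2 + c 0 1 * y * z ^ 3 + c 0 0 * z ^ 4 := by
  let f : Fin 3 → MvPolynomial (Fin 3) ℂ :=
    fun i => C (u i) * X 0 + C (v i) * X 1 + C (w i) * X 2
  have hf : ∀ i, (f i).IsHomogeneous 1 := fun i =>
    ((isHomogeneous_C_mul_X _ _).add (isHomogeneous_C_mul_X _ _)).add (isHomogeneous_C_mul_X _ _)
  have hG : (aeval f F).IsHomogeneous 4 := by simpa using hF.aeval f hf
  obtain ⟨c, hc⟩ := exists_eval_eq_sum_of_isHomogeneous hG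
  refine ⟨c, fun x y z => ?_⟩
  have : eval (x • u + y • v + z • w) F = eval ![x, y, z] (aeval f F) := by
    rw [← coe_aeval_eq_eval, ← coe_aeval_eq_eval]
    simp only [RingHom.coe_coe, ← AlgHom.comp_apply, comp_aeval]
    congr 2
    ext i
    simp [f]
    ring
  rw [this, hc]
  simp [Finset.sum_range_succ]
  ring

theorem exists_eval_eq_linearMap (φ : (Fin 3 → ℂ) →ₗ[ℂ] ℂ) :
    ∃ ℓ : MvPolynomial (Fin 3) ℂ, ∀ p, eval p ℓ = φ p :=
  ⟨∑ i, C (φ (Pi.single i 1)) * X i, fun p => by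
    conv_rhs => rw [LinearMap.pi_apply_eq_sum_univ φ p]
    simp only [map_sum, map_mul, eval_C, eval_X, smul_eq_mul]
    refine Finset.sum_congr rfl fun i _ => ?_
    rw [mul_comm]
    congr
    ext j
    simp [Pi.single_apply, eq_comm]⟩

theorem exists_coord_polynomials {u v w : Fin 3 → ℂ} (h : LinearIndependent ℂ ![u, v, w]) :
    ∃ ξ η ζ : MvPolynomial (Fin 3) ℂ, ∀ p,
      p = eval p ξ • u + eval p η • v + eval p ζ • w := by
  let b := basisOfLinearIndependentOfCardEqFinrank h (by simp)
  obtain ⟨ξ, hξ⟩ := exists_eval_eq_linearMap (b.coord 0)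
  obtain ⟨η, hη⟩ := exists_eval_eq_linearMap (b.coord 1)
  obtain ⟨ζ, hζ⟩ := exists_eval_eq_linearMap (b.coord 2)
  refine ⟨ξ, η, ζ, fun p => ?_⟩
  rw [hξ, hη, hζ]
  conv_lhs => rw [← b.sum_repr p]
  simp [b, Fin.sum_univ_three]

/-- A quartic divisible by a linear form is reducible. -/
theorem not_irreducible_of_eval_eq {F : MvPolynomial (Fin 3) ℂ} {u v w : Fin 3 → ℂ}
    (h : LinearIndependent ℂ ![u, v, w]) {a b c d e g k l : ℂ}
    (heval : ∀ x y z : ℂ, eval (x • u + y • v + z • w) F =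
      z * (a * x ^ 2 * y + b * x ^ 2 * z + c * x * y ^ 2 + d * x * y * z + e * x * z ^ 2 +
        g * y ^ 2 * z + k * y * z ^ 2 + l * z ^ 3)) : ¬ Irreducible F := by
  intro hirr
  obtain ⟨ξ, η, ζ, hp⟩ := exists_coord_polynomials h
  have h0 := frame_coord_eq_zero h (hp 0).symm
  have hfac : F = ζ * (C a * ξ ^ 2 * η + C b * ξ ^ 2 * ζ + C c * ξ * η ^ 2 + C d * ξ * η * ζ +
      C e * ξ * ζ ^ 2 + C g * η ^ 2 * ζ + C k * η * ζ ^ 2 + C l * ζ ^ 3) := by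
    refine MvPolynomial.funext fun p => ?_
    conv_lhs => rw [hp p, heval]
    simp
  rcases hirr.isUnit_or_isUnit hfac with hu | hu
  · exact not_isUnit_zero (h0.2.2 ▸ hu.map (eval (0 : Fin 3 → ℂ)))
  · have := hu.map (eval (0 : Fin 3 → ℂ))
    simp only [map_add, map_mul, map_pow, h0] at this
    simp at this

section Normalize

variable {F : MvPolynomial (Fin 3) ℂ} {a : Fin 3 → ℂ}

theorem coeff_one_lineRest_of_isSingularAt (hF : F.IsHomogeneous 4) {ha : a ≠ 0}
    (h : IsSingularAt F (Projectivization.mk ℂ a ha)) (b : Fin 3 → ℂ) :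
    (lineRest F a b).coeff 1 = 0 := by
  rw [coeff_one_lineRest]
  simp [((isSingularAt_mk_iff hF ha).1 h).2]

theorem isSingularAt_of_frame (hF : F.IsHomogeneous 4) {u v w : Fin 3 → ℂ}
    (hi : LinearIndependent ℂ ![u, v, w]) (ha : a ≠ 0) (h0 : eval a F = 0)
    (hu : (lineRest F a u).coeff 1 = 0) (hv : (lineRest F a v).coeff 1 = 0)
    (hw : (lineRest F a w).coeff 1 = 0) : IsSingularAt F (Projectivization.mk ℂ a ha) := by
  refine (isSingularAt_mk_iff hF ha).2 ⟨h0, fun i => ?_⟩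
  rw [coeff_one_lineRest] at hu hv hw
  obtain ⟨x, y, z, he⟩ := exists_frame_coord hi (Pi.single i 1)
  have key : ∑ j, (Pi.single i 1 : Fin 3 → ℂ) j * eval a (pderiv j F) = 0 := by
    rw [he]
    simp only [Fin.sum_univ_three, Pi.add_apply, Pi.smul_apply, smul_eq_mul] at hu hv hw ⊢
    linear_combination x * hu + y * hv + z * hw
  simpa [Pi.single_apply] using key

theorem coeff_ne_zero_of_ordinaryNode {u v w : Fin 3 → ℂ} (hi : LinearIndependent ℂ ![u, v, w])
    (hu : u ≠ 0) (h : OrdinaryNode F (Projectivization.mk ℂ u hu)) {A B C D E G : ℂ}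
    (heval : ∀ x y z : ℂ, eval (x • u + y • v + z • w) F = x ^ 2 * y ^ 2 + A * x ^ 2 * z ^ 2 +
      B * y ^ 2 * z ^ 2 + C * x * y * z ^ 2 + D * x * z ^ 3 + E * y * z ^ 3 + G * z ^ 4) :
    A ≠ 0 := by
  rintro rfl
  obtain ⟨b₁, b₂, hb, h₁, h₂⟩ := h.2 u hu rfl
  have key : ∀ b, coneCoeff F u b = 0 → ∃ x z : ℂ, b = x • u + z • w := by
    intro b hb
    obtain ⟨x, y, z, rfl⟩ := exists_frame_coord hi b
    have hcone : coneCoeff F u (x • u + y • v + z • w) = y ^ 2 := by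
      refine coneCoeff_eq (e₀ := 0) (e₁ := 0) (e₃ := 2 * x * y ^ 2 + C * y * z ^ 2 + D * z ^ 3)
        (e₄ := x ^ 2 * y ^ 2 + B * y ^ 2 * z ^ 2 + C * x * y * z ^ 2 + D * x * z ^ 3 +
          E * y * z ^ 3 + G * z ^ 4) fun t => ?_
      have : u + t • (x • u + y • v + z • w) =
          (1 + t * x) • u + (t * y) • v + (t * z) • w := by module
      rw [this, heval]
      ring
    rw [hcone] at hb
    exact ⟨x, z, by simp [pow_eq_zero_iff two_ne_zero |>.1 hb]⟩
  obtain ⟨x₁, z₁, rfl⟩ := key b₁ h₁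
  obtain ⟨x₂, z₂, rfl⟩ := key b₂ h₂
  have h0 := frame_coord_eq_zero hb (x := z₁ * x₂ - z₂ * x₁) (y := z₂) (z := -z₁) (by module)
  have hz : z₁ = 0 := by simpa using h0.2.2
  have := (frame_coord_eq_zero hb (x := x₁) (y := -1) (z := 0) (by rw [hz]; module)).2.1
  simp at this

end Normalize

theorem exists_frame {p₁ p₂ : P2} (hne : p₁ ≠ p₂) : ∃ (u v w : Fin 3 → ℂ) (hu : u ≠ 0)
    (hv : v ≠ 0), LinearIndependent ℂ ![u, v, w] ∧ p₁ = Projectivization.mk ℂ u hu ∧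
      p₂ = Projectivization.mk ℂ v hv := by
  obtain ⟨u, hu, rfl⟩ : ∃ u hu, p₁ = Projectivization.mk ℂ u hu :=
    ⟨p₁.rep, p₁.rep_nonzero, p₁.mk_rep.symm⟩
  obtain ⟨v, hv, rfl⟩ : ∃ v hv, p₂ = Projectivization.mk ℂ v hv :=
    ⟨p₂.rep, p₂.rep_nonzero, p₂.mk_rep.symm⟩
  have huv : LinearIndependent ℂ ![v, u] := by
    refine (LinearIndependent.pair_iff' hv).2 fun k hk => hne ?_
    exact (Projectivization.mk_eq_mk_iff' ℂ _ _ hu hv).2 ⟨k, hk⟩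
  obtain ⟨w, hw⟩ := exists_linearIndependent_cons_of_lt_finrank huv (by simp)
  refine ⟨u, v, w, hu, hv, ?_, rfl, rfl⟩
  have hrev : ![u, v, w] = (Fin.cons w ![v, u] : Fin 3 → Fin 3 → ℂ) ∘ Fin.rev := by
    ext i
    fin_cases i <;> rfl
  rw [hrev]
  exact hw.comp _ Fin.rev_injective

theorem nodalFrame_of_eval_eq {F : MvPolynomial (Fin 3) ℂ} (hF : F.IsHomogeneous 4)
    {u v w : Fin 3 → ℂ} (hi : LinearIndependent ℂ ![u, v, w]) (hu : u ≠ 0) (hv : v ≠ 0)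
    (h₁ : OrdinaryNode F (Projectivization.mk ℂ u hu))
    (h₂ : OrdinaryNode F (Projectivization.mk ℂ v hv))
    (honly : ∀ q : P2, IsSingularAt F q →
      q = Projectivization.mk ℂ u hu ∨ q = Projectivization.mk ℂ v hv) {A B C D E G : ℂ}
    (heval : ∀ x y z : ℂ, eval (x • u + y • v + z • w) F = x ^ 2 * y ^ 2 + A * x ^ 2 * z ^ 2 +
      B * y ^ 2 * z ^ 2 + C * x * y * z ^ 2 + D * x * z ^ 3 + E * y * z ^ 3 + G * z ^ 4) :
    NodalFrame F (Projectivization.mk ℂ u hu) (Projectivization.mk ℂ v hv) u v w A B C D E G where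
  A_ne := coeff_ne_zero_of_ordinaryNode hi hu h₁ heval
  B_ne := coeff_ne_zero_of_ordinaryNode (C := C) (D := E) (E := D) (G := G) (B := A)
    hi.frame_swap hv h₂ fun x y z => by
      rw [add_comm (x • v), heval]
      ring
  smooth x y h hx hy := by
    have hne : x • u + y • v + (1 : ℂ) • w ≠ 0 := fun h0 =>
      one_ne_zero (frame_coord_eq_zero hi h0).2.2
    have hsing : IsSingularAt F (Projectivization.mk ℂ _ hne) := by
      refine isSingularAt_of_frame hF hi hne ?_ ?_ ?_ ?_
      · rw [heval, ← h]
        ring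
      · rw [← hx]
        refine coeff_one_lineRest_eq
          (e₀ := x ^ 2 * y ^ 2 + A * x ^ 2 + B * y ^ 2 + C * x * y + D * x + E * y + G)
          (e₂ := y ^ 2 + A) (e₃ := 0) (e₄ := 0) fun t => ?_
        have : x • u + y • v + (1 : ℂ) • w + t • u = (x + t) • u + y • v + (1 : ℂ) • w := by module
        rw [this, heval]
        ring
      · rw [← hy]
        refine coeff_one_lineRest_eq
          (e₀ := x ^ 2 * y ^ 2 + A * x ^ 2 + B * y ^ 2 + C * x * y + D * x + E * y + G)
          (e₂ := x ^ 2 + B) (e₃ := 0) (e₄ := 0) fun t => ?_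
        have : x • u + y • v + (1 : ℂ) • w + t • v = x • u + (y + t) • v + (1 : ℂ) • w := by module
        rw [this, heval]
        ring
      · have hw : (lineRest F (x • u + y • v + (1 : ℂ) • w) w).coeff 1 =
            2 * A * x ^ 2 + 2 * B * y ^ 2 + 2 * C * x * y + 3 * D * x + 3 * E * y + 4 * G := by
          refine coeff_one_lineRest_eq
            (e₀ := x ^ 2 * y ^ 2 + A * x ^ 2 + B * y ^ 2 + C * x * y + D * x + E * y + G)
            (e₂ := A * x ^ 2 + B * y ^ 2 + C * x * y + 3 * D * x + 3 * E * y + 6 * G)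
            (e₃ := D * x + E * y + 4 * G) (e₄ := G) fun t => ?_
          have : x • u + y • v + (1 : ℂ) • w + t • w = x • u + y • v + (1 + t) • w := by module
          rw [this, heval]
          ring
        rw [hw]
        linear_combination 4 * h - x * hx - y * hy
    rcases honly _ hsing with he | he <;>
      obtain ⟨k, hk⟩ := (Projectivization.mk_eq_mk_iff' ℂ _ _ _ _).1 he
    · exact one_ne_zero (frame_coord_eq hi (x' := k) (y' := 0) (z' := 0)
        (by simpa using hk.symm)).2.2
    · exact one_ne_zero (frame_coord_eq hi (x' := 0) (y' := k) (z' := 0)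
        (by simpa using hk.symm)).2.2
  homogeneous := hF
  indep := hi
  left_eq := ⟨hu, rfl⟩
  right_eq := ⟨hv, rfl⟩
  singular_iff p := ⟨honly p, by rintro (rfl | rfl); exacts [h₁.1.1, h₂.1.1]⟩
  eval_eq := heval

theorem exists_nodalFrame {F : MvPolynomial (Fin 3) ℂ} (hF : F.IsHomogeneous 4)
    (hirr : Irreducible F) {p₁ p₂ : P2} (hne : p₁ ≠ p₂) (h₁ : OrdinaryNode F p₁)
    (h₂ : OrdinaryNode F p₂) (honly : ∀ q : P2, IsSingularAt F q → q = p₁ ∨ q = p₂) :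
    ∃ u v w A B C D E G, NodalFrame F p₁ p₂ u v w A B C D E G := by
  obtain ⟨u₀, v, w₀, hu₀, hv, hi₀, rfl, rfl⟩ := exists_frame hne
  obtain ⟨c, hc⟩ := exists_eval_frame_eq hF u₀ v w₀
  have s₁ := coeff_one_lineRest_of_isSingularAt hF h₁.1.1
  have s₂ := coeff_one_lineRest_of_isSingularAt hF h₂.1.1
  have c40 : c 4 0 = 0 := by
    have := ((isSingularAt_mk_iff hF hu₀).1 h₁.1.1).1
    have h := hc 1 0 0
    simpa [this] using h.symm
  have c04 : c 0 4 = 0 := by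
    have := ((isSingularAt_mk_iff hF hv).1 h₂.1.1).1
    have h := hc 0 1 0
    simpa [this] using h.symm
  have c31 : c 3 1 = 0 := by
    rw [← s₁ v]
    refine (coeff_one_lineRest_eq (e₀ := c 4 0) (e₂ := c 2 2) (e₃ := c 1 3) (e₄ := c 0 4)
      fun t => ?_).symm
    have := hc 1 t 0
    rw [one_smul, zero_smul, add_zero] at this
    rw [this]; ring
  have c30 : c 3 0 = 0 := by
    rw [← s₁ w₀]
    refine (coeff_one_lineRest_eq (e₀ := c 4 0) (e₂ := c 2 0) (e₃ := c 1 0) (e₄ := c 0 0)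
      fun t => ?_).symm
    have := hc 1 0 t
    rw [one_smul, zero_smul, add_zero] at this
    rw [this]; ring
  have c13 : c 1 3 = 0 := by
    rw [← s₂ u₀]
    refine (coeff_one_lineRest_eq (e₀ := c 0 4) (e₂ := c 2 2) (e₃ := c 3 1) (e₄ := c 4 0)
      fun t => ?_).symm
    have := hc t 1 0
    rw [one_smul, zero_smul, add_zero, add_comm] at this
    rw [this]; ring
  have c03 : c 0 3 = 0 := by
    rw [← s₂ w₀]
    refine (coeff_one_lineRest_eq (e₀ := c 0 4) (e₂ := c 0 2) (e₃ := c 0 1) (e₄ := c 0 0)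
      fun t => ?_).symm
    have := hc 0 1 t
    rw [one_smul, zero_smul, zero_add] at this
    rw [this]; ring
  simp only [c40, c04, c31, c30, c13, c03, zero_mul, zero_add, add_zero] at hc
  have c22 : c 2 2 ≠ 0 := by
    intro c22
    refine not_irreducible_of_eval_eq hi₀ (a := c 2 1) (b := c 2 0) (c := c 1 2) (d := c 1 1)
      (e := c 1 0) (g := c 0 2) (k := c 0 1) (l := c 0 0) (fun x y z => ?_) hirr
    rw [hc, c22]
    ring
  obtain ⟨k, hk⟩ := IsAlgClosed.exists_pow_nat_eq (c 2 2) (n := 2) (by norm_num)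
  have hk0 : k ≠ 0 := by
    rintro rfl
    exact c22 (by simpa using hk.symm)
  obtain ⟨m, hm⟩ : ∃ m, c 1 2 = 2 * k * m := ⟨c 1 2 / (2 * k), by field_simp⟩
  obtain ⟨n, hn⟩ : ∃ n, c 2 1 = 2 * k ^ 2 * n := ⟨c 2 1 / (2 * k ^ 2), by field_simp⟩
  set u := k⁻¹ • u₀ with hu_def
  have hu₀' : u₀ = k • u := (smul_inv_smul₀ hk0 u₀).symm
  have hu : u ≠ 0 := smul_ne_zero (inv_ne_zero hk0) hu₀
  have hmk : Projectivization.mk ℂ u₀ hu₀ = Projectivization.mk ℂ u hu :=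
    (Projectivization.mk_eq_mk_iff' ℂ _ _ _ _).2 ⟨k, hu₀'.symm⟩
  have hi : LinearIndependent ℂ ![u, v, w₀ - m • u - n • v] := by
    refine Fintype.linearIndependent_iff.2 fun g hg => ?_
    simp only [Fin.sum_univ_three, Matrix.cons_val] at hg
    obtain ⟨h0, h1, h2⟩ := frame_coord_eq_zero hi₀ (x := k⁻¹ * (g 0 - m * g 2))
      (y := g 1 - n * g 2) (z := g 2) (by rw [← hg, hu_def]; module)
    rw [h2, mul_zero, sub_zero] at h0 h1
    intro i
    fin_cases i
    exacts [(mul_eq_zero.1 h0).resolve_left (inv_ne_zero hk0), h1, h2]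
  rw [hmk] at h₁ honly ⊢
  refine ⟨u, v, _, _, _, _, _, _, _, nodalFrame_of_eval_eq hF hi hu hv h₁ h₂ honly
    (A := c 2 0 / k ^ 2 - n ^ 2) (B := c 0 2 - m ^ 2) (C := c 1 1 / k - 4 * m * n)
    (D := 4 * m * n ^ 2 - 2 * m * c 2 0 / k ^ 2 - n * c 1 1 / k + c 1 0 / k)
    (E := 4 * m ^ 2 * n - 2 * n * c 0 2 - m * c 1 1 / k + c 0 1)
    (G := c 2 0 * m ^ 2 / k ^ 2 - 3 * m ^ 2 * n ^ 2 + c 0 2 * n ^ 2 + c 1 1 * m * n / k -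
      c 1 0 * m / k - c 0 1 * n + c 0 0) fun x y z => ?_⟩
  have : x • u + y • v + z • (w₀ - m • u - n • v) =
      ((x - m * z) / k) • u₀ + (y - n * z) • v + z • w₀ := by
    rw [hu_def, div_eq_mul_inv]
    module
  rw [this, hc, hm, hn, ← hk]
  field_simp
  ring

/-- An irreducible plane quartic whose only singularities are two
ordinary nodes has exactly 8 theta-lines of type 0, exactly 8 of type 1 (four through
each node), and exactly 1 of type 2, namely the line joining the two nodes. -/
theorem binodal_quartic_theta_lines
    (F : MvPolynomial (Fin 3) ℂ) (hF4 : F.IsHomogeneous 4) (hirr : Irreducible F)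
    (p₁ p₂ : P2) (hne : p₁ ≠ p₂)
    (h₁ : OrdinaryNode F p₁) (h₂ : OrdinaryNode F p₂)
    (honly : ∀ q : P2, IsSingularAt F q → q = p₁ ∨ q = p₂) :
    {S : Set P2 | ThetaLineOfType F 0 S}.ncard = 8 ∧
    {S : Set P2 | ThetaLineOfType F 1 S}.ncard = 8 ∧
    {S : Set P2 | ThetaLineOfType F 1 S ∧ p₁ ∈ S}.ncard = 4 ∧
    {S : Set P2 | ThetaLineOfType F 1 S ∧ p₂ ∈ S}.ncard = 4 ∧
    {S : Set P2 | ThetaLineOfType F 2 S}.ncard = 1 ∧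
    (∀ S : Set P2, ThetaLineOfType F 2 S → p₁ ∈ S ∧ p₂ ∈ S) := by
  obtain ⟨u, v, w, A, B, C, D, E, G, h⟩ := exists_nodalFrame hF4 hirr hne h₁ h₂ honly
  refine ⟨h.ncard_type_zero, h.ncard_type_one, h.ncard_type_one_left, h.symm.ncard_type_one_left,
    h.ncard_type_two, fun S hS => ?_⟩
  rw [h.eq_join_of_type_two hS]
  exact ⟨h.left_mem_join, h.right_mem_join⟩

end
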